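/- arXiv:hep-th/0211179 — 9 statements merged into one kernel-verified Lean document; each statement's English description precedes it below -/
import Mathlib

section
/- Bogomolnyi bound: let L > 0, let Q be a nonnegative integer, and let F : [0,π] → ℝ be continuously differentiable with F(0) = 0 and F(π) = Q·π. Then the energy E[F] = 4πL·∫₀^π sin²ψ·( F'(ψ)² + 2·sin²F(ψ)/sin²ψ + (2/L²)·( F'(ψ)² + sin²F(ψ)/(2·sin²ψ) )·( sin²F(ψ)/sin²ψ ) ) dψ satisfies E[F] ≥ 12π²·Q. -/
open Real Set intervalIntegral

/-- A function on `[0, π]` with derivative bounded by `K`, taking values in `π ℤ` at both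
endpoints, satisfies `|sin (F x)| ≤ (K π / 2) sin x`. -/
lemma abs_sin_comp_le_mul_sin {F : ℝ → ℝ} {K : ℝ}
    (hF : DifferentiableOn ℝ F (Icc 0 π))
    (hK : ∀ x ∈ Icc 0 π, ‖derivWithin F (Icc 0 π) x‖ ≤ K)
    (h0 : ∃ n : ℤ, F 0 = n * π) (hπ : ∃ n : ℤ, F π = n * π)
    {x : ℝ} (hx : x ∈ Icc 0 π) : |sin (F x)| ≤ K * π / 2 * sin x := by
  have hK0 : 0 ≤ K := (norm_nonneg _).trans (hK x hx)
  have endpoint_bound : ∀ y ∈ Icc 0 π, (∃ n : ℤ, F y = n * π) → |sin (F x)| ≤ K * |x - y| := by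
    rintro y hy ⟨n, hn⟩
    have hlip := (convex_Icc 0 π).norm_image_sub_le_of_norm_derivWithin_le hF hK hy hx
    have hsin : |sin (F x)| = |sin (F x - F y)| := by
      rw [hn, sin_sub_int_mul_pi, abs_mul, abs_zpow, abs_neg, abs_one, one_zpow, one_mul]
    rw [hsin]
    exact abs_sin_le_abs.trans hlip
  have scale : ∀ t : ℝ, 2 / π * t ≤ sin x → K * t ≤ K * π / 2 * sin x := fun t ht =>
    calc K * t = K * π / 2 * (2 / π * t) := by field_simp
      _ ≤ K * π / 2 * sin x := by gcongr
  rcases le_total x (π / 2) with h | h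
  · have hb := endpoint_bound 0 (left_mem_Icc.2 pi_nonneg) h0
    rw [sub_zero, abs_of_nonneg hx.1] at hb
    exact hb.trans (scale x (mul_le_sin hx.1 h))
  · have hb := endpoint_bound π (right_mem_Icc.2 pi_nonneg) hπ
    rw [abs_sub_comm, abs_of_nonneg (sub_nonneg.2 hx.2)] at hb
    refine hb.trans (scale _ ?_)
    rw [← sin_pi_sub x]
    exact mul_le_sin (sub_nonneg.2 hx.2) (by linarith)

/-- The Skyrme energy density as a function of the strain `d`, the value `S = sin F` and
the weight `s = sin ψ`. -/
lemma energy_density_eq {L s : ℝ} (hs : s ≠ 0) (d S : ℝ) :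
    s ^ 2 * (d ^ 2 + 2 * S ^ 2 / s ^ 2 +
      (2 / L ^ 2) * (d ^ 2 + S ^ 2 / (2 * s ^ 2)) * (S ^ 2 / s ^ 2)) =
    s ^ 2 * d ^ 2 + 2 * S ^ 2 + 2 / L ^ 2 * (d ^ 2 * S ^ 2 + S ^ 2 * (S / s) ^ 2 / 2) := by
  field_simp

/-- Completing the squares in the Skyrme energy density. -/
lemma le_energy_density {L s : ℝ} (hL : L ≠ 0) (hs : s ≠ 0) (d S : ℝ) :
    6 / L * (d * S ^ 2) ≤
    s ^ 2 * (d ^ 2 + 2 * S ^ 2 / s ^ 2 +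
      (2 / L ^ 2) * (d ^ 2 + S ^ 2 / (2 * s ^ 2)) * (S ^ 2 / s ^ 2)) := by
  have key : s ^ 2 * (d ^ 2 + 2 * S ^ 2 / s ^ 2 +
      (2 / L ^ 2) * (d ^ 2 + S ^ 2 / (2 * s ^ 2)) * (S ^ 2 / s ^ 2)) - 6 / L * (d * S ^ 2) =
      (s * d - S ^ 2 / (L * s)) ^ 2 + 2 * (S * (1 - d / L)) ^ 2 := by
    field_simp
    ring
  have : 0 ≤ (s * d - S ^ 2 / (L * s)) ^ 2 + 2 * (S * (1 - d / L)) ^ 2 := by positivity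
  linarith

lemma integrableOn_energy_density {F : ℝ → ℝ} (L : ℝ)
    (hF : ContDiffOn ℝ 1 F (Icc 0 π))
    (h0 : ∃ n : ℤ, F 0 = n * π) (hπ : ∃ n : ℤ, F π = n * π) :
    MeasureTheory.IntegrableOn (fun ψ => sin ψ ^ 2 *
      (deriv F ψ ^ 2 + 2 * sin (F ψ) ^ 2 / sin ψ ^ 2 +
        (2 / L ^ 2) * (deriv F ψ ^ 2 + sin (F ψ) ^ 2 / (2 * sin ψ ^ 2)) *
          (sin (F ψ) ^ 2 / sin ψ ^ 2))) (Icc 0 π) := by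
  rw [integrableOn_Icc_iff_integrableOn_Ioo]
  obtain ⟨K, hK⟩ := isCompact_Icc.exists_bound_of_continuousOn
    (hF.continuousOn_derivWithin (uniqueDiffOn_Icc pi_pos) le_rfl)
  have hF' : ContinuousOn (deriv F) (Ioo 0 π) :=
    (hF.mono Ioo_subset_Icc_self).continuousOn_deriv_of_isOpen isOpen_Ioo le_rfl
  have hFc : ContinuousOn F (Ioo 0 π) := hF.continuousOn.mono Ioo_subset_Icc_self
  have hs : ∀ x ∈ Ioo 0 π, sin x ≠ 0 := fun x hx => (sin_pos_of_mem_Ioo hx).ne'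
  have hcont : ContinuousOn (fun ψ => sin ψ ^ 2 * deriv F ψ ^ 2 + 2 * sin (F ψ) ^ 2 +
      2 / L ^ 2 * (deriv F ψ ^ 2 * sin (F ψ) ^ 2 +
        sin (F ψ) ^ 2 * (sin (F ψ) / sin ψ) ^ 2 / 2)) (Ioo 0 π) := by
    fun_prop (disch := assumption)
  refine MeasureTheory.IntegrableOn.congr_fun ?_
    (fun x hx => (energy_density_eq (hs x hx) _ _).symm) measurableSet_Ioo
  refine MeasureTheory.Integrable.of_bound (hcont.aestronglyMeasurable measurableSet_Ioo)
    (1 * K ^ 2 + 2 * 1 + 2 / L ^ 2 * (K ^ 2 * 1 + 1 * (K * π / 2) ^ 2 / 2)) ?_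
  filter_upwards [MeasureTheory.ae_restrict_mem measurableSet_Ioo] with x hx
  have hd : deriv F x ^ 2 ≤ K ^ 2 := by
    have := hK x (Ioo_subset_Icc_self hx)
    rw [derivWithin_of_mem_nhds (Icc_mem_nhds hx.1 hx.2), norm_eq_abs] at this
    exact sq_le_sq' (abs_le.1 this).1 (abs_le.1 this).2
  have hq : (sin (F x) / sin x) ^ 2 ≤ (K * π / 2) ^ 2 := by
    have := abs_sin_comp_le_mul_sin (hF.differentiableOn one_ne_zero) hK h0 hπ
      (Ioo_subset_Icc_self hx)
    have hpos := sin_pos_of_mem_Ioo hx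
    rw [← div_le_iff₀ hpos, ← abs_of_pos hpos, ← abs_div] at this
    exact sq_le_sq' (abs_le.1 this).1 (abs_le.1 this).2
  have h1 := sin_sq_le_one x
  have h2 := sin_sq_le_one (F x)
  rw [norm_of_nonneg (by positivity)]
  gcongr

/-- Bogomolnyi bound for the hedgehog Skyrme model on the three-sphere:
for a continuously differentiable shape function `F` on `[0, π]` with
`F 0 = 0` and `F π = Q·π`, the energy is at least `12·π²·Q`. -/
theorem bogomolny_bound
    (L : ℝ) (hL : 0 < L) (Q : ℕ) (F : ℝ → ℝ)
    (hF : ContDiffOn ℝ 1 F (Set.Icc 0 Real.pi))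
    (hF0 : F 0 = 0) (hFπ : F Real.pi = Q * Real.pi) :
    4 * Real.pi * L *
        ∫ ψ in (0:ℝ)..Real.pi,
          Real.sin ψ ^ 2 *
            (deriv F ψ ^ 2 + 2 * Real.sin (F ψ) ^ 2 / Real.sin ψ ^ 2 +
              (2 / L ^ 2) *
                (deriv F ψ ^ 2 + Real.sin (F ψ) ^ 2 / (2 * Real.sin ψ ^ 2)) *
                (Real.sin (F ψ) ^ 2 / Real.sin ψ ^ 2)) ≥
      12 * Real.pi ^ 2 * Q := by
  have hFc := hF.continuousOn
  have hderiv : ∀ x ∈ Ioo 0 π,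
      HasDerivAt (fun ψ => 3 / L * (F ψ - sin (F ψ) * cos (F ψ)))
        (6 / L * (deriv F x * sin (F x) ^ 2)) x := by
    intro x hx
    have hd : HasDerivAt F (deriv F x) x :=
      ((hF.differentiableOn one_ne_zero).differentiableAt
        (Icc_mem_nhds hx.1 hx.2)).hasDerivAt
    refine ((hd.sub (hd.sin.mul hd.cos)).const_mul (3 / L)).congr_deriv ?_
    linear_combination -(3 / L * deriv F x) * sin_sq_add_cos_sq (F x)
  have hbound := sub_le_integral_of_hasDeriv_right_of_le pi_nonneg (by fun_prop)
    (fun x hx => (hderiv x hx).hasDerivWithinAt)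
    (integrableOn_energy_density L hF ⟨0, by simp [hF0]⟩ ⟨Q, by simpa using hFπ⟩)
    (fun x hx => le_energy_density hL.ne' (sin_pos_of_mem_Ioo hx).ne' _ _)
  rw [hF0, hFπ, sin_nat_mul_pi] at hbound
  calc 12 * π ^ 2 * Q
      = 4 * π * L * (3 / L * (Q * π - 0 * cos (Q * π)) - 3 / L * (0 - sin 0 * cos 0)) := by
        rw [sin_zero]
        field_simp
        ring
    _ ≤ _ := by gcongr
end

section
/- Interior critical points are local minima: let κ > 0 and let F be twice differentiable on (0,π) and solve the hedgehog Skyrme ODE on (0,π). If ψ₀ ∈ (0,π) satisfies F'(ψ₀) = 0 and 0 < F(ψ₀) < π/2, then F''(ψ₀) > 0. -/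
open Real Set Filter Topology

/-- The hedgehog Skyrme ODE on the three-sphere with coupling constant `κ`:
`(sin²ψ + κ²·sin²F)·F'' + sin(2ψ)·F' + (κ²/2)·sin(2F)·F'² − sin(2F)
  − (κ²/2)·(sin²F/sin²ψ)·sin(2F) = 0` on `(0, π)`. -/
def SkyrmeEq (κ : ℝ) (F : ℝ → ℝ) : Prop :=
  ∀ ψ ∈ Set.Ioo (0:ℝ) Real.pi,
    (Real.sin ψ ^ 2 + κ ^ 2 * Real.sin (F ψ) ^ 2) * deriv (deriv F) ψ
      + Real.sin (2 * ψ) * deriv F ψ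
      + κ ^ 2 / 2 * Real.sin (2 * F ψ) * deriv F ψ ^ 2
      - Real.sin (2 * F ψ)
      - κ ^ 2 / 2 * (Real.sin (F ψ) ^ 2 / Real.sin ψ ^ 2) * Real.sin (2 * F ψ) = 0

/-- `F` is twice differentiable on `(0, π)`. -/
def TwiceDiffOnIoo (F : ℝ → ℝ) : Prop :=
  ∀ ψ ∈ Set.Ioo (0:ℝ) Real.pi,
    DifferentiableAt ℝ F ψ ∧ DifferentiableAt ℝ (deriv F) ψ

/-- Interior critical points are local minima: at a point `ψ₀ ∈ (0,π)` with
`F'(ψ₀) = 0` and `0 < F(ψ₀) < π/2`, a solution of the hedgehog Skyrme ODE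
satisfies `F''(ψ₀) > 0`. -/
theorem skyrme_critical_point_min (κ : ℝ) (hκ : 0 < κ) (F : ℝ → ℝ)
    (hF : TwiceDiffOnIoo F) (hode : SkyrmeEq κ F)
    (ψ₀ : ℝ) (hψ₀ : ψ₀ ∈ Set.Ioo (0:ℝ) Real.pi)
    (hcrit : deriv F ψ₀ = 0) (h1 : 0 < F ψ₀) (h2 : F ψ₀ < Real.pi / 2) :
    0 < deriv (deriv F) ψ₀ := by
  have hψ : 0 < Real.sin ψ₀ := Real.sin_pos_of_mem_Ioo hψ₀
  have hsin : 0 < Real.sin (2 * F ψ₀) :=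
    Real.sin_pos_of_pos_of_lt_pi (by linarith) (by linarith)
  have hcoeff : 0 < Real.sin ψ₀ ^ 2 + κ ^ 2 * Real.sin (F ψ₀) ^ 2 := by positivity
  have hforce : 0 ≤ κ ^ 2 / 2 * (Real.sin (F ψ₀) ^ 2 / Real.sin ψ₀ ^ 2) *
      Real.sin (2 * F ψ₀) := by positivity
  have heq := hode ψ₀ hψ₀
  rw [hcrit] at heq
  exact pos_of_mul_pos_right (by linarith) hcoeff.le
end

section
/- Monotonicity of the modified energy density: let κ > 0 and let F be twice differentiable on (0,π) and solve the hedgehog Skyrme ODE on (0,π). Then the function g(ψ) = sin²ψ·(Q(ψ) + 1/2), where Q(ψ) = (1/4)·F'(ψ)²·(sin²ψ + κ²·sin²F(ψ)) − (1/2)·sin²F(ψ) − (κ²/8)·sin⁴F(ψ)/sin²ψ, is nondecreasing on the interval (0, π/2). -/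
open Real Set Filter Topology

/-- Along a solution of the hedgehog Skyrme ODE, the modified energy density (with the
denominator `sin²ψ` cleared) has derivative `sin ψ cos ψ (κ²/2 · sin²F · F'² + cos²F)`. -/
theorem SkyrmeEq.hasDerivAt_modified_energy {κ : ℝ} {F : ℝ → ℝ} (hode : SkyrmeEq κ F)
    (hF : TwiceDiffOnIoo F) {x : ℝ} (hx : x ∈ Ioo (0 : ℝ) π) :
    HasDerivAt
      (fun ψ => sin ψ ^ 2 *
        (1 / 4 * deriv F ψ ^ 2 * (sin ψ ^ 2 + κ ^ 2 * sin (F ψ) ^ 2)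
          - 1 / 2 * sin (F ψ) ^ 2 + 1 / 2) - κ ^ 2 / 8 * sin (F ψ) ^ 4)
      (sin x * cos x * (κ ^ 2 / 2 * sin (F x) ^ 2 * deriv F x ^ 2 + cos (F x) ^ 2)) x := by
  have hs : sin x ≠ 0 := (sin_pos_of_mem_Ioo hx).ne'
  have hsin := (hasDerivAt_sin x).pow 2
  have hp := (hF x hx).2.hasDerivAt.pow 2
  have hsinF := (hF x hx).1.hasDerivAt.sin
  have h := (hsin.mul ((((hp.const_mul (1 / 4)).mul
    (hsin.add ((hsinF.pow 2).const_mul (κ ^ 2)))).sub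
    ((hsinF.pow 2).const_mul (1 / 2))).add_const (1 / 2))).sub
    ((hsinF.pow 4).const_mul (κ ^ 2 / 8))
  refine h.congr_deriv ?_
  have key := hode x hx
  rw [sin_two_mul, sin_two_mul] at key
  have hC : cos (F x) ^ 2 = 1 - sin (F x) ^ 2 := cos_sq' _
  field_simp at key
  simp only [Pi.add_apply, Pi.mul_apply, Pi.pow_apply, Pi.sub_apply]
  rw [hC]
  push_cast
  linear_combination (deriv F x / 2) * key

/-- Monotonicity of the modified energy density: for a solution `F` of the
hedgehog Skyrme ODE, the function `g(ψ) = sin²ψ·(Q(ψ) + 1/2)`, where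
`Q(ψ) = (1/4)·F'²·(sin²ψ + κ²·sin²F) − (1/2)·sin²F − (κ²/8)·sin⁴F/sin²ψ`,
is nondecreasing on `(0, π/2)`. -/
theorem skyrme_modified_energy_monotone (κ : ℝ) (hκ : 0 < κ) (F : ℝ → ℝ)
    (hF : TwiceDiffOnIoo F) (hode : SkyrmeEq κ F) :
    MonotoneOn
      (fun ψ => Real.sin ψ ^ 2 *
        ((1 / 4 * deriv F ψ ^ 2 * (Real.sin ψ ^ 2 + κ ^ 2 * Real.sin (F ψ) ^ 2)
            - 1 / 2 * Real.sin (F ψ) ^ 2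
            - κ ^ 2 / 8 * Real.sin (F ψ) ^ 4 / Real.sin ψ ^ 2) + 1 / 2))
      (Set.Ioo (0:ℝ) (Real.pi / 2)) := by
  have hsub : ∀ {x : ℝ}, x ∈ Ioo (0 : ℝ) (π / 2) → x ∈ Ioo (0 : ℝ) π := fun hx =>
    ⟨hx.1, by linarith [hx.1, hx.2]⟩
  have hmono := monotoneOn_of_hasDerivWithinAt_nonneg (convex_Ioo (0 : ℝ) (π / 2))
    (fun x hx => (hode.hasDerivAt_modified_energy hF (hsub hx)).continuousAt.continuousWithinAt)
    (fun x hx => (hode.hasDerivAt_modified_energy hF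
      (hsub (interior_subset hx))).hasDerivWithinAt)
    (fun x hx => by
      have hx' := interior_subset hx
      have hs := sin_pos_of_mem_Ioo (hsub hx')
      have hc := cos_pos_of_mem_Ioo ⟨by linarith [hx'.1, pi_pos], hx'.2⟩
      positivity)
  refine hmono.congr fun x hx => ?_
  have hs : sin x ≠ 0 := (sin_pos_of_mem_Ioo (hsub hx)).ne'
  field_simp
  ring
end

section
/- Let κ > 0 and let F be twice differentiable on (0,π) and solve the hedgehog Skyrme ODE on (0,π). Then the function ψ ↦ Q(ψ)·sin²ψ converges to a finite limit as ψ → 0⁺, where Q(ψ) = (1/4)·F'(ψ)²·(sin²ψ + κ²·sin²F(ψ)) − (1/2)·sin²F(ψ) − (κ²/8)·sin⁴F(ψ)/sin²ψ. -/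
open Real Set Filter Topology

/-- Along a solution, `Q·sin²ψ + sin²ψ/2` has derivative
`sin ψ · cos ψ · (cos²F + (κ²/2)·sin²F·F'²)`. -/
theorem hasDerivAt_skyrme_Q_sin_sq_add {κ : ℝ} {F : ℝ → ℝ}
    (hF : TwiceDiffOnIoo F) (hode : SkyrmeEq κ F) {ψ : ℝ} (hψ : ψ ∈ Ioo 0 π) :
    HasDerivAt
      (fun ψ => (1 / 4 * deriv F ψ ^ 2 * (sin ψ ^ 2 + κ ^ 2 * sin (F ψ) ^ 2)
          - 1 / 2 * sin (F ψ) ^ 2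
          - κ ^ 2 / 8 * sin (F ψ) ^ 4 / sin ψ ^ 2) * sin ψ ^ 2 + sin ψ ^ 2 / 2)
      (sin ψ * cos ψ * (cos (F ψ) ^ 2 + κ ^ 2 / 2 * sin (F ψ) ^ 2 * deriv F ψ ^ 2)) ψ := by
  obtain ⟨h₁, h₂⟩ := hF ψ hψ
  have hs : sin ψ ≠ 0 := (sin_pos_of_mem_Ioo hψ).ne'
  have hode := hode ψ hψ
  have dF := h₁.hasDerivAt
  have dp := h₂.hasDerivAt
  have ds := (hasDerivAt_sin ψ).pow 2
  have dS := dF.sin.pow 2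
  have hQ := (((((dp.pow 2).const_mul (1 / 4)).mul (ds.add (dS.const_mul (κ ^ 2)))).sub
    (dS.const_mul (1 / 2))).sub
    (((dF.sin.pow 4).const_mul (κ ^ 2 / 8)).div ds (pow_ne_zero 2 hs)))
  refine ((hQ.mul ds).add (ds.div_const 2)).congr_deriv ?_
  rw [sin_two_mul, sin_two_mul] at hode
  have hC : cos (F ψ) ^ 2 = 1 - sin (F ψ) ^ 2 := cos_sq' _
  simp only [Pi.add_apply, Pi.sub_apply, Pi.mul_apply, Pi.div_apply, Pi.pow_apply]
  rw [hC]
  generalize deriv (deriv F) ψ = q at *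
  generalize deriv F ψ = p at *
  generalize sin ψ = s at *
  generalize sin (F ψ) = S at *
  generalize cos ψ = c at *
  generalize cos (F ψ) = C at *
  field_simp at hode ⊢
  push_cast
  linear_combination (32 * p * s ^ 2) * hode

/-- For a solution `F` of the hedgehog Skyrme ODE on `(0,π)`, the function
`ψ ↦ Q(ψ)·sin²ψ` converges to a finite limit as `ψ → 0⁺`, where
`Q(ψ) = (1/4)·F'²·(sin²ψ + κ²·sin²F) − (1/2)·sin²F − (κ²/8)·sin⁴F/sin²ψ`. -/
theorem skyrme_Q_sin_sq_limit (κ : ℝ) (hκ : 0 < κ) (F : ℝ → ℝ)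
    (hF : TwiceDiffOnIoo F) (hode : SkyrmeEq κ F) :
    ∃ a : ℝ, Filter.Tendsto
      (fun ψ => (1 / 4 * deriv F ψ ^ 2 * (Real.sin ψ ^ 2 + κ ^ 2 * Real.sin (F ψ) ^ 2)
          - 1 / 2 * Real.sin (F ψ) ^ 2
          - κ ^ 2 / 8 * Real.sin (F ψ) ^ 4 / Real.sin ψ ^ 2) * Real.sin ψ ^ 2)
      (nhdsWithin 0 (Set.Ioi 0)) (nhds a) := by
  set G : ℝ → ℝ := fun ψ =>
    (1 / 4 * deriv F ψ ^ 2 * (sin ψ ^ 2 + κ ^ 2 * sin (F ψ) ^ 2)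
      - 1 / 2 * sin (F ψ) ^ 2 - κ ^ 2 / 8 * sin (F ψ) ^ 4 / sin ψ ^ 2) * sin ψ ^ 2 with hG
  have hsub : Ioo 0 (π / 2) ⊆ Ioo 0 π := Ioo_subset_Ioo_right (by linarith [pi_pos])
  have hderiv : ∀ ψ ∈ Ioo 0 (π / 2), HasDerivAt (fun ψ => G ψ + sin ψ ^ 2 / 2) _ ψ :=
    fun ψ hψ => hasDerivAt_skyrme_Q_sin_sq_add hF hode (hsub hψ)
  have hmono : MonotoneOn (fun ψ => G ψ + sin ψ ^ 2 / 2) (Ioo 0 (π / 2)) := by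
    refine monotoneOn_of_deriv_nonneg (convex_Ioo _ _)
      (fun ψ hψ => (hderiv ψ hψ).continuousAt.continuousWithinAt) ?_ ?_ <;>
      rw [interior_Ioo]
    · exact fun ψ hψ => (hderiv ψ hψ).differentiableAt.differentiableWithinAt
    · intro ψ hψ
      rw [(hderiv ψ hψ).deriv]
      have hs := sin_pos_of_mem_Ioo (hsub hψ)
      have hc := cos_pos_of_mem_Ioo ⟨by linarith [hψ.1, pi_pos], hψ.2⟩
      positivity
  have hbdd : BddBelow ((fun ψ => G ψ + sin ψ ^ 2 / 2) '' Ioo 0 (π / 2)) := by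
    refine ⟨-(κ ^ 2 / 8), ?_⟩
    rintro _ ⟨ψ, hψ, rfl⟩
    have hs := sin_pos_of_mem_Ioo (hsub hψ)
    have hGψ : G ψ + sin ψ ^ 2 / 2 =
        1 / 4 * deriv F ψ ^ 2 * (sin ψ ^ 2 + κ ^ 2 * sin (F ψ) ^ 2) * sin ψ ^ 2
          + sin ψ ^ 2 / 2 * (1 - sin (F ψ) ^ 2) - κ ^ 2 / 8 * sin (F ψ) ^ 4 := by
      simp only [hG]
      field_simp
      ring
    have hS : sin (F ψ) ^ 2 ≤ 1 := sin_sq_le_one _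
    have hS4 : κ ^ 2 / 8 * sin (F ψ) ^ 4 ≤ κ ^ 2 / 8 :=
      mul_le_of_le_one_right (by positivity) (by nlinarith [sq_nonneg (sin (F ψ))])
    have hfirst : 0 ≤ 1 / 4 * deriv F ψ ^ 2 * (sin ψ ^ 2 + κ ^ 2 * sin (F ψ) ^ 2)
        * sin ψ ^ 2 := by positivity
    have hsecond : 0 ≤ sin ψ ^ 2 / 2 * (1 - sin (F ψ) ^ 2) :=
      mul_nonneg (by positivity) (by linarith)
    simp only [hGψ]
    linarith
  have hlim := hmono.tendsto_nhdsWithin_Ioo_right (nonempty_Ioo.2 pi_div_two_pos) hbdd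
  have hsin : Tendsto (fun ψ => sin ψ ^ 2 / 2) (𝓝[>] 0) (𝓝 (sin 0 ^ 2 / 2)) :=
    ((by fun_prop : Continuous fun ψ : ℝ => sin ψ ^ 2 / 2).tendsto 0).mono_left
      nhdsWithin_le_nhds
  exact ⟨_, (hlim.sub hsin).congr fun ψ => add_sub_cancel_right _ _⟩
end

section
/- Existence of a boundary limit at the north pole: let κ > 0 and let F be twice differentiable on (0,π) and solve the hedgehog Skyrme ODE on (0,π). Then F(ψ) tends to a finite limit as ψ → 0⁺. -/
open Real Set Filter Topology

lemma exists_mem_Ioo_cos_two_mul_ne {a b : ℝ} (hab : a < b) (c : ℝ) :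
    ∃ y ∈ Ioo a b, cos (2 * y) ≠ c := by
  by_contra! h
  have hlin (y : ℝ) : HasDerivAt (fun y : ℝ => 2 * y) 2 y := by
    simpa using (hasDerivAt_id y).const_mul 2
  have hsin : ∀ y ∈ Ioo a b, sin (2 * y) = 0 := by
    intro y hy
    have hconst : HasDerivAt (fun y => cos (2 * y)) 0 y :=
      (hasDerivAt_const y c).congr_of_eventuallyEq <| by
        filter_upwards [isOpen_Ioo.mem_nhds hy] with z hz using h z hz
    have := (hlin y).cos.unique hconst
    linarith
  obtain ⟨y, hy⟩ := nonempty_Ioo.2 hab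
  have hconst : HasDerivAt (fun y => sin (2 * y)) 0 y :=
    (hasDerivAt_const y (0 : ℝ)).congr_of_eventuallyEq <| by
      filter_upwards [isOpen_Ioo.mem_nhds hy] with z hz using hsin z hz
  have hcos := (hlin y).sin.unique hconst
  have := sin_sq_add_cos_sq (2 * y)
  rw [hsin y hy] at this
  nlinarith

lemma lt_of_continuousOn_of_forall_ne {f : ℝ → ℝ} {s : Set ℝ} (hs : IsPreconnected s)
    (hf : ContinuousOn f s) {y x₀ x : ℝ} (hne : ∀ z ∈ s, f z ≠ y) (hx₀ : x₀ ∈ s) (hx : x ∈ s)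
    (h : f x₀ < y) : f x < y := by
  by_contra! hle
  obtain ⟨z, hz, hzy⟩ := hs.intermediate_value hx₀ hx hf ⟨h.le, hle⟩
  exact hne z hz hzy

/-- A continuous function converges at the left endpoint of an interval as soon as the cosine of
its double does. -/
lemma exists_tendsto_of_tendsto_cos_two_mul {f : ℝ → ℝ} {r c : ℝ} (hr : 0 < r)
    (hf : ContinuousOn f (Ioo 0 r))
    (hc : Tendsto (fun x => cos (2 * f x)) (𝓝[>] 0) (𝓝 c)) :
    ∃ a, Tendsto f (𝓝[>] 0) (𝓝 a) := by
  have avoid : ∀ y, cos (2 * y) ≠ c →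
      ∃ δ, 0 < δ ∧ δ ≤ r ∧ ∀ x ∈ Ioo 0 δ, cos (2 * f x) ≠ cos (2 * y) := by
    intro y hy
    obtain ⟨δ, hδ, h⟩ := mem_nhdsGT_iff_exists_Ioo_subset.1 (hc.eventually_ne hy.symm)
    exact ⟨min δ r, lt_min hδ hr, min_le_right _ _,
      fun x hx => h ⟨hx.1, hx.2.trans_le (min_le_left _ _)⟩⟩
  obtain ⟨y, -, hy⟩ := exists_mem_Ioo_cos_two_mul_ne zero_lt_one c
  obtain ⟨δ, hδ, hδr, hav⟩ := avoid y hy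
  have hfδ : ContinuousOn f (Ioo 0 δ) := hf.mono (Ioo_subset_Ioo_right hδr)
  have hx₀ : δ / 2 ∈ Ioo 0 δ := ⟨by linarith, by linarith⟩
  have hshift (n : ℤ) : ∀ z ∈ Ioo 0 δ, f z ≠ y + n * π := by
    intro z hz h
    apply hav z hz
    rw [h, show 2 * (y + n * π) = 2 * y + n * (2 * π) by ring, cos_add_int_mul_two_pi]
  have hev : ∀ᶠ x in 𝓝[>] (0 : ℝ), x ∈ Ioo 0 δ := Ioo_mem_nhdsGT hδ
  refine tendsto_of_no_upcrossings dense_univ ?_ ?_ ?_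
  · rintro a - b - hab ⟨ha, hb⟩
    obtain ⟨w, hw, hwc⟩ := exists_mem_Ioo_cos_two_mul_ne hab c
    obtain ⟨ε, hε, hεr, hav'⟩ := avoid w hwc
    have hev' : ∀ᶠ x in 𝓝[>] (0 : ℝ), x ∈ Ioo 0 ε := Ioo_mem_nhdsGT hε
    obtain ⟨x₁, h₁, hx₁⟩ := (ha.and_eventually hev').exists
    obtain ⟨x₂, h₂, hx₂⟩ := (hb.and_eventually hev').exists
    have := lt_of_continuousOn_of_forall_ne isPreconnected_Ioo
      (hf.mono (Ioo_subset_Ioo_right hεr)) (y := w)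
      (fun z hz h => hav' z hz (by rw [h])) hx₁ hx₂ (h₁.trans hw.1)
    linarith [hw.2]
  · obtain ⟨n, hn⟩ := exists_int_gt ((f (δ / 2) - y) / π)
    rw [div_lt_iff₀ pi_pos] at hn
    refine ⟨y + n * π, eventually_map.2 (hev.mono fun x hx => ?_)⟩
    exact (lt_of_continuousOn_of_forall_ne isPreconnected_Ioo hfδ (hshift n) hx₀ hx
      (by linarith)).le
  · obtain ⟨n, hn⟩ := exists_int_lt ((f (δ / 2) - y) / π)
    rw [lt_div_iff₀ pi_pos] at hn
    refine ⟨y + n * π, eventually_map.2 (hev.mono fun x hx => ?_)⟩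
    have := lt_of_continuousOn_of_forall_ne isPreconnected_Ioo hfδ.neg (y := -(y + n * π))
      (fun z hz h => hshift n z hz (neg_inj.1 h)) hx₀ hx (neg_lt_neg (by linarith))
    exact (neg_lt_neg_iff.1 this).le

lemma monotoneOn_Ioo_of_hasDerivAt_nonneg {f f' : ℝ → ℝ} {a b : ℝ}
    (hf : ∀ x ∈ Ioo a b, HasDerivAt f (f' x) x) (hf' : ∀ x ∈ Ioo a b, 0 ≤ f' x) :
    MonotoneOn f (Ioo a b) := by
  refine monotoneOn_of_deriv_nonneg (convex_Ioo a b)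
    (fun x hx => (hf x hx).continuousAt.continuousWithinAt) ?_ ?_
  · rw [interior_Ioo]
    exact fun x hx => (hf x hx).differentiableAt.differentiableWithinAt
  · rw [interior_Ioo]
    exact fun x hx => (hf x hx).deriv ▸ hf' x hx

lemma mul_sub_le_sub_of_hasDerivAt {f f' : ℝ → ℝ} {a b C : ℝ} (hab : a ≤ b)
    (hf : ∀ x ∈ Icc a b, HasDerivAt f (f' x) x) (hf' : ∀ x ∈ Icc a b, C ≤ f' x) :
    C * (b - a) ≤ f b - f a := by
  refine (convex_Icc a b).mul_sub_le_image_sub_of_le_deriv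
    (fun x hx => (hf x hx).continuousAt.continuousWithinAt) ?_ ?_ a (left_mem_Icc.2 hab) b
    (right_mem_Icc.2 hab) hab
  · exact fun x hx => (hf x (interior_subset hx)).differentiableAt.differentiableWithinAt
  · exact fun x hx => (hf x (interior_subset hx)).deriv ▸ hf' x (interior_subset hx)

/-- `sin²ψ` times the Hamiltonian of the hedgehog Skyrme Lagrangian, plus `sin²ψ`. It is
nondecreasing on `(0, π/2)` along solutions. -/
noncomputable def skyrmeEnergy (κ : ℝ) (F : ℝ → ℝ) (ψ : ℝ) : ℝ :=
  1 / 2 * (sin ψ ^ 2 + κ ^ 2 * sin (F ψ) ^ 2) * (sin ψ * deriv F ψ) ^ 2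
    - sin ψ ^ 2 * sin (F ψ) ^ 2 - κ ^ 2 / 4 * sin (F ψ) ^ 4 + sin ψ ^ 2

lemma hasDerivAt_skyrmeEnergy {κ : ℝ} {F : ℝ → ℝ} (hF : TwiceDiffOnIoo F)
    (hode : SkyrmeEq κ F) {ψ : ℝ} (hψ : ψ ∈ Ioo 0 π) :
    HasDerivAt (skyrmeEnergy κ F)
      (sin ψ * cos ψ * (κ ^ 2 * sin (F ψ) ^ 2 * deriv F ψ ^ 2 + 2 * cos (F ψ) ^ 2)) ψ := by
  have hs : sin ψ ≠ 0 := (sin_pos_of_pos_of_lt_pi hψ.1 hψ.2).ne'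
  have h1 := (hF ψ hψ).1.hasDerivAt
  have h2 := (hF ψ hψ).2.hasDerivAt
  have h0 := hasDerivAt_sin ψ
  have hS := h1.sin
  have h := ((((((h0.pow 2).add ((hS.pow 2).const_mul (κ ^ 2))).const_mul (1 / 2)).mul
    ((h0.mul h2).pow 2)).sub ((h0.pow 2).mul (hS.pow 2))).sub
    ((hS.pow 4).const_mul (κ ^ 2 / 4))).add (h0.pow 2)
  refine h.congr_deriv ?_
  have e := hode ψ hψ
  rw [sin_two_mul, sin_two_mul] at e
  field_simp at e
  have hc : cos (F ψ) ^ 2 = 1 - sin (F ψ) ^ 2 := cos_sq' _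
  simp only [Pi.add_apply, Pi.mul_apply, Pi.pow_apply]
  rw [hc]
  push_cast
  linear_combination deriv F ψ * e

lemma half_le_cos_of_mem_Ioo {x : ℝ} (hx : x ∈ Ioo (0 : ℝ) 1) : 1 / 2 ≤ cos x := by
  nlinarith [one_sub_sq_div_two_le_cos (x := x), hx.1, hx.2]

lemma half_mul_le_sin_of_mem_Ioo {x : ℝ} (hx : x ∈ Ioo (0 : ℝ) 1) : x / 2 ≤ sin x := by
  have h := sin_gt_sub_cube hx.1
  have h2 : x ^ 2 ≤ 1 := pow_le_one₀ hx.1.le hx.2.le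
  nlinarith [mul_le_mul_of_nonneg_left h2 hx.1.le, hx.1]

lemma skyrmeEnergy_add_quartic (κ : ℝ) (F : ℝ → ℝ) (ψ : ℝ) :
    skyrmeEnergy κ F ψ + κ ^ 2 / 4 * sin (F ψ) ^ 4 =
      1 / 2 * (sin ψ ^ 2 + κ ^ 2 * sin (F ψ) ^ 2) * (sin ψ * deriv F ψ) ^ 2
        + sin ψ ^ 2 * cos (F ψ) ^ 2 := by
  rw [skyrmeEnergy, cos_sq']
  ring

lemma sin_pow_four_le_sin_sq (x : ℝ) : sin x ^ 4 ≤ sin x ^ 2 := by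
  nlinarith [sin_sq_le_one x, sq_nonneg (sin x)]

lemma neg_quartic_le_skyrmeEnergy (κ : ℝ) (F : ℝ → ℝ) (ψ : ℝ) :
    -(κ ^ 2 / 4 * sin (F ψ) ^ 4) ≤ skyrmeEnergy κ F ψ := by
  have h := skyrmeEnergy_add_quartic κ F ψ
  have : 0 ≤ 1 / 2 * (sin ψ ^ 2 + κ ^ 2 * sin (F ψ) ^ 2) * (sin ψ * deriv F ψ) ^ 2
        + sin ψ ^ 2 * cos (F ψ) ^ 2 := by positivity
  linarith

lemma quartic_le (κ x : ℝ) : κ ^ 2 / 4 * sin x ^ 4 ≤ κ ^ 2 / 4 := by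
  have h : sin x ^ 4 ≤ 1 := (sin_pow_four_le_sin_sq x).trans (sin_sq_le_one x)
  nlinarith [sq_nonneg κ]

/-- Lower bound for the scaled slope `sin ψ * F' ψ` in terms of the energy. -/
lemma le_mul_sq_slope (κ : ℝ) (F : ℝ → ℝ) (ψ : ℝ) :
    2 * (skyrmeEnergy κ F ψ + κ ^ 2 / 4 * sin (F ψ) ^ 4 - sin ψ ^ 2) ≤
      (1 + κ ^ 2) * (sin ψ * deriv F ψ) ^ 2 := by
  rw [skyrmeEnergy_add_quartic]
  have h1 : sin ψ ^ 2 + κ ^ 2 * sin (F ψ) ^ 2 ≤ 1 + κ ^ 2 := by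
    nlinarith [sin_sq_le_one ψ, sin_sq_le_one (F ψ), sq_nonneg κ]
  have h2 : sin ψ ^ 2 * cos (F ψ) ^ 2 ≤ sin ψ ^ 2 := by
    nlinarith [cos_sq_le_one (F ψ), sq_nonneg (sin ψ)]
  nlinarith [mul_le_mul_of_nonneg_right h1 (sq_nonneg (sin ψ * deriv F ψ))]

lemma mem_Ioo_zero_pi_of_mem_Ioo {x : ℝ} (hx : x ∈ Ioo (0 : ℝ) 1) : x ∈ Ioo 0 π :=
  ⟨hx.1, hx.2.trans (by linarith [pi_gt_three])⟩

lemma sin_pos_of_mem_Ioo {x : ℝ} (hx : x ∈ Ioo (0 : ℝ) 1) : 0 < sin x :=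
  sin_pos_of_pos_of_lt_pi hx.1 (mem_Ioo_zero_pi_of_mem_Ioo hx).2

lemma le_deriv_skyrmeEnergy (κ : ℝ) (F : ℝ → ℝ) {x : ℝ} (hx : x ∈ Ioo (0 : ℝ) 1) :
    κ ^ 2 / 2 * sin x * sin (F x) ^ 2 * deriv F x ^ 2 ≤
      sin x * cos x * (κ ^ 2 * sin (F x) ^ 2 * deriv F x ^ 2 + 2 * cos (F x) ^ 2) := by
  have hs := sin_pos_of_mem_Ioo hx
  have h1 : 0 ≤ sin x * (κ ^ 2 * sin (F x) ^ 2 * deriv F x ^ 2) := by positivity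
  have h2 : 0 ≤ sin x * cos (F x) ^ 2 := by positivity
  nlinarith [mul_le_mul_of_nonneg_right (half_le_cos_of_mem_Ioo hx) h1,
    mul_le_mul_of_nonneg_right (half_le_cos_of_mem_Ioo hx) h2]

lemma monotoneOn_skyrmeEnergy {κ : ℝ} {F : ℝ → ℝ} (hF : TwiceDiffOnIoo F)
    (hode : SkyrmeEq κ F) : MonotoneOn (skyrmeEnergy κ F) (Ioo 0 1) := by
  refine monotoneOn_Ioo_of_hasDerivAt_nonneg
    (fun x hx => hasDerivAt_skyrmeEnergy hF hode (mem_Ioo_zero_pi_of_mem_Ioo hx)) fun x hx => ?_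
  have := sin_pos_of_mem_Ioo hx
  have := half_le_cos_of_mem_Ioo hx
  positivity

/-- The energy converges at the north pole, to its infimum. -/
lemma exists_tendsto_skyrmeEnergy {κ : ℝ} {F : ℝ → ℝ} (hF : TwiceDiffOnIoo F)
    (hode : SkyrmeEq κ F) :
    ∃ L, Tendsto (skyrmeEnergy κ F) (𝓝[>] 0) (𝓝 L) ∧
      ∀ x ∈ Ioo (0 : ℝ) 1, L ≤ skyrmeEnergy κ F x := by
  have hb : BddBelow (skyrmeEnergy κ F '' Ioo 0 1) := by
    refine ⟨-(κ ^ 2 / 4), ?_⟩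
    rintro - ⟨x, -, rfl⟩
    linarith [neg_quartic_le_skyrmeEnergy κ F x, quartic_le κ (F x)]
  exact ⟨_, (monotoneOn_skyrmeEnergy hF hode).tendsto_nhdsWithin_Ioo_right
    (nonempty_Ioo.2 zero_lt_one) hb, fun x hx => csInf_le hb (mem_image_of_mem _ hx)⟩

/-- The scaled slope of a solution cannot stay bounded away from zero with a fixed sign: otherwise
`F` would wind infinitely often and the energy would be unbounded. -/
lemma not_forall_le_scaled_slope {κ : ℝ} (hκ : 0 < κ) {F : ℝ → ℝ} (hF : TwiceDiffOnIoo F)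
    (hode : SkyrmeEq κ F) {r m σ : ℝ} (hr : 0 < r) (hr1 : r ≤ 1) (hm : 0 < m) (hσ : σ ^ 2 = 1) :
    ¬ ∀ x ∈ Ioo 0 r, m ≤ sin x * (σ * deriv F x) := by
  intro h
  have hsub : ∀ x ∈ Ioo 0 r, x ∈ Ioo (0 : ℝ) 1 := fun x hx => ⟨hx.1, hx.2.trans_le hr1⟩
  have hderiv : ∀ x ∈ Ioo 0 r, HasDerivAt F (deriv F x) x := fun x hx =>
    (hF x (mem_Ioo_zero_pi_of_mem_Ioo (hsub x hx))).1.hasDerivAt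
  have hpos : ∀ x ∈ Ioo 0 r, 0 < σ * deriv F x := fun x hx =>
    pos_of_mul_pos_right (hm.trans_le (h x hx)) (sin_pos_of_mem_Ioo (hsub x hx)).le
  have hlog : MonotoneOn (fun x => σ * F x - m * log x) (Ioo 0 r) := by
    refine monotoneOn_Ioo_of_hasDerivAt_nonneg (fun x hx => ((hderiv x hx).const_mul σ).sub
      ((hasDerivAt_log hx.1.ne').const_mul m)) fun x hx => ?_
    rw [sub_nonneg, ← div_eq_mul_inv, div_le_iff₀ hx.1]
    nlinarith [h x hx, mul_le_mul_of_nonneg_left (sin_lt hx.1).le (hpos x hx).le]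
  have hwind : MonotoneOn (fun x => skyrmeEnergy κ F x
      - κ ^ 2 / 2 * m * σ * (F x / 2 - sin (2 * F x) / 4)) (Ioo 0 r) := by
    refine monotoneOn_Ioo_of_hasDerivAt_nonneg (fun x hx =>
      (hasDerivAt_skyrmeEnergy hF hode (mem_Ioo_zero_pi_of_mem_Ioo (hsub x hx))).sub
      ((((hderiv x hx).div_const 2).sub
        ((((hderiv x hx).const_mul 2).sin).div_const 4)).const_mul (κ ^ 2 / 2 * m * σ)))
      fun x hx => ?_
    have h1 := le_deriv_skyrmeEnergy κ F (hsub x hx)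
    have h2 : 0 ≤ κ ^ 2 / 2 * sin (F x) ^ 2 * (σ * deriv F x) := by
      have := hpos x hx
      positivity
    have h3 := mul_le_mul_of_nonneg_left (h x hx) h2
    have h4 : κ ^ 2 / 2 * sin (F x) ^ 2 * (σ * deriv F x) * (sin x * (σ * deriv F x)) =
        κ ^ 2 / 2 * sin x * sin (F x) ^ 2 * deriv F x ^ 2 := by
      linear_combination (κ ^ 2 / 2 * sin x * sin (F x) ^ 2 * deriv F x ^ 2) * hσ
    have h5 : deriv F x / 2 - cos (2 * F x) * (2 * deriv F x) / 4 =
        sin (F x) ^ 2 * deriv F x := by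
      rw [cos_two_mul, cos_sq']
      ring
    rw [h5]
    nlinarith
  have hmid : r / 2 ∈ Ioo 0 r := ⟨by linarith, by linarith⟩
  set W := skyrmeEnergy κ F (r / 2)
      - κ ^ 2 / 2 * m * σ * (F (r / 2) / 2 - sin (2 * F (r / 2)) / 4) with hW
  set V := σ * F (r / 2) - m * log (r / 2) with hV
  have key : ∀ x ∈ Ioc 0 (r / 2),
      -(κ ^ 2 / 4) - W ≤ κ ^ 2 / 2 * m * ((V + m * log x) / 2 + 1 / 4) := by
    intro x hx
    have hx' : x ∈ Ioo 0 r := ⟨hx.1, hx.2.trans_lt hmid.2⟩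
    have h1 := hlog hx' hmid hx.2
    have h2 := hwind hx' hmid hx.2
    simp only at h1 h2
    have h3 : -(σ * sin (2 * F x)) ≤ 1 := by
      nlinarith [sq_nonneg (σ + sin (2 * F x)), sin_sq_le_one (2 * F x)]
    have h4 : σ * (F x / 2 - sin (2 * F x) / 4) ≤ (V + m * log x) / 2 + 1 / 4 := by
      linarith
    have h5 := mul_le_mul_of_nonneg_left h4 (show 0 ≤ κ ^ 2 / 2 * m by positivity)
    linarith [neg_quartic_le_skyrmeEnergy κ F x, quartic_le κ (F x)]
  have hlim : Tendsto (fun x => κ ^ 2 / 2 * m * ((V + m * log x) / 2 + 1 / 4)) (𝓝[>] 0) atBot :=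
    (tendsto_atBot_add_const_right _ _ ((tendsto_atBot_add_const_left _ _
      (tendsto_log_nhdsGT_zero.const_mul_atBot hm)).atBot_div_const two_pos)).const_mul_atBot
      (by positivity)
  obtain ⟨x, hx, hx'⟩ := ((hlim.eventually_lt_atBot (-(κ ^ 2 / 4) - W)).and
    (Ioc_mem_nhdsGT hmid.1)).exists
  linarith [key x hx']

lemma skyrmeEnergy_limit_nonpos {κ : ℝ} (hκ : 0 < κ) {F : ℝ → ℝ} (hF : TwiceDiffOnIoo F)
    (hode : SkyrmeEq κ F) {L : ℝ} (hL : ∀ x ∈ Ioo (0 : ℝ) 1, L ≤ skyrmeEnergy κ F x) : L ≤ 0 := by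
  by_contra! hpos
  obtain ⟨r, hr, hr1, hrL⟩ : ∃ r, 0 < r ∧ r ≤ 1 ∧ r ^ 2 ≤ L / 2 :=
    ⟨min 1 (√(L / 2)), lt_min one_pos (by positivity), min_le_left _ _, by
      calc _ ≤ √(L / 2) ^ 2 := by gcongr; exact min_le_right _ _
        _ = _ := sq_sqrt (by positivity)⟩
  set m := √(L / (1 + κ ^ 2)) with hmdef
  have hm : 0 < m := by positivity
  have habs : ∀ x ∈ Ioo 0 r, m ≤ |sin x * deriv F x| := by
    intro x hx
    have hx1 : x ∈ Ioo (0 : ℝ) 1 := ⟨hx.1, hx.2.trans_le hr1⟩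
    have h1 := le_mul_sq_slope κ F x
    have h2 : sin x ^ 2 ≤ r ^ 2 := by
      have := sin_pos_of_mem_Ioo hx1
      gcongr
      exact (sin_lt hx.1).le.trans hx.2.le
    have h3 : 0 ≤ κ ^ 2 / 4 * sin (F x) ^ 4 := by positivity
    rw [hmdef, ← sqrt_sq_eq_abs]
    refine sqrt_le_sqrt ?_
    rw [div_le_iff₀ (by positivity)]
    linarith [hL x hx1]
  have hcont : ContinuousOn (fun x => sin x * deriv F x) (Ioo 0 r) := fun x hx =>
    (continuous_sin.continuousAt.mul (hF x (mem_Ioo_zero_pi_of_mem_Ioo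
      ⟨hx.1, hx.2.trans_le hr1⟩)).2.continuousAt).continuousWithinAt
  have hne : ∀ x ∈ Ioo 0 r, sin x * deriv F x ≠ 0 := fun x hx h0 => by
    have := habs x hx
    rw [h0, abs_zero] at this
    linarith
  have hmid : r / 2 ∈ Ioo 0 r := ⟨by linarith, by linarith⟩
  rcases lt_or_gt_of_ne (hne _ hmid) with hneg | hgt
  · refine not_forall_le_scaled_slope hκ hF hode hr hr1 hm (σ := -1) (by norm_num) fun x hx => ?_
    have hlt := lt_of_continuousOn_of_forall_ne isPreconnected_Ioo hcont hne hmid hx hneg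
    have := habs x hx
    rw [abs_of_neg hlt] at this
    linarith
  · refine not_forall_le_scaled_slope hκ hF hode hr hr1 hm (σ := 1) (by norm_num) fun x hx => ?_
    have hlt := lt_of_continuousOn_of_forall_ne isPreconnected_Ioo hcont.neg (y := 0)
      (fun z hz h0 => hne z hz (neg_eq_zero.1 h0)) hmid hx (neg_lt_zero.2 hgt)
    have := habs x hx
    rw [abs_of_pos (neg_lt_zero.1 hlt)] at this
    linarith

lemma hasDerivAt_quartic (κ : ℝ) {F : ℝ → ℝ} {x : ℝ} (hF : DifferentiableAt ℝ F x) :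
    HasDerivAt (fun x => κ ^ 2 / 4 * sin (F x) ^ 4)
      (κ ^ 2 * sin (F x) ^ 3 * cos (F x) * deriv F x) x := by
  refine ((hF.hasDerivAt.sin.pow 4).const_mul (κ ^ 2 / 4)).congr_deriv ?_
  push_cast
  ring

lemma exists_deriv_quartic_bound {κ : ℝ} {F : ℝ → ℝ} (hF : TwiceDiffOnIoo F)
    (hode : SkyrmeEq κ F) :
    ∃ M, 0 < M ∧ ∀ x ∈ Ioo (0 : ℝ) (1 / 2),
      |κ ^ 2 * sin (F x) ^ 3 * cos (F x) * deriv F x| ≤ M / x := by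
  set B := |skyrmeEnergy κ F (1 / 2)| + κ ^ 2 / 4 with hB
  have hB0 : 0 ≤ B := by positivity
  refine ⟨κ ^ 2 + 2 * B + 1, by positivity, fun x hx => ?_⟩
  have hx1 : x ∈ Ioo (0 : ℝ) 1 := ⟨hx.1, by linarith [hx.2]⟩
  have hs := sin_pos_of_mem_Ioo hx1
  have hs2 := half_mul_le_sin_of_mem_Ioo hx1
  have hE : skyrmeEnergy κ F x ≤ skyrmeEnergy κ F (1 / 2) :=
    monotoneOn_skyrmeEnergy hF hode hx1 (by norm_num) hx.2.le
  have hE' := skyrmeEnergy_add_quartic κ F x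
  set p := |sin (F x) * (sin x * deriv F x)| with hp
  have hpB : κ ^ 2 * p ^ 2 ≤ 2 * B := by
    rw [hp, sq_abs]
    have h1 : 0 ≤ sin x ^ 2 * (sin x * deriv F x) ^ 2 := by positivity
    have h2 : 0 ≤ sin x ^ 2 * cos (F x) ^ 2 := by positivity
    nlinarith [quartic_le κ (F x), le_abs_self (skyrmeEnergy κ F (1 / 2))]
  have hp1 : κ ^ 2 * p ≤ (κ ^ 2 + 2 * B) / 2 := by
    nlinarith [mul_nonneg (sq_nonneg κ) (sq_nonneg (p - 1))]
  have hsc : |sin (F x) ^ 2 * cos (F x)| ≤ 1 := by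
    rw [abs_mul, abs_of_nonneg (sq_nonneg _)]
    exact mul_le_one₀ (sin_sq_le_one _) (abs_nonneg _) (abs_cos_le_one _)
  have hmul : |κ ^ 2 * sin (F x) ^ 3 * cos (F x) * deriv F x| * sin x ≤ κ ^ 2 * p := by
    have heq : |κ ^ 2 * sin (F x) ^ 3 * cos (F x) * deriv F x| * sin x =
        κ ^ 2 * p * |sin (F x) ^ 2 * cos (F x)| := by
      simp only [hp, abs_mul, abs_pow, abs_of_pos hs]
      rw [sq_abs κ]
      ring
    rw [heq]
    exact mul_le_of_le_one_right (by positivity) hsc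
  rw [le_div_iff₀ hx.1]
  nlinarith [mul_le_mul_of_nonneg_left hs2
    (abs_nonneg (κ ^ 2 * sin (F x) ^ 3 * cos (F x) * deriv F x))]

/-- If the quartic term exceeds `-L` by `2 * ε` at a small `x`, then the energy increases by a
definite amount on `[x, (1 + δ) * x]`. -/
lemma energy_gain_of_quartic {κ : ℝ} {F : ℝ → ℝ} (hF : TwiceDiffOnIoo F)
    (hode : SkyrmeEq κ F) {L : ℝ} (hL : ∀ x ∈ Ioo (0 : ℝ) 1, L ≤ skyrmeEnergy κ F x)
    (hL0 : L ≤ 0) {M : ℝ} (hM : ∀ x ∈ Ioo (0 : ℝ) (1 / 2),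
      |κ ^ 2 * sin (F x) ^ 3 * cos (F x) * deriv F x| ≤ M / x)
    {ε δ x : ℝ} (hε : 0 < ε) (hδ : 0 < δ) (hδ1 : δ ≤ 1) (hδM : M * δ ≤ ε) (hM0 : 0 < M)
    (hx : x ∈ Ioo (0 : ℝ) (1 / 4)) (hxε : 8 * x ^ 2 ≤ ε)
    (h : 2 * ε ≤ κ ^ 2 / 4 * sin (F x) ^ 4 + L) :
    δ * (ε ^ 2 / (1 + κ ^ 2)) ≤
      skyrmeEnergy κ F ((1 + δ) * x) - skyrmeEnergy κ F x := by
  have hx0 := hx.1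
  have hrange : ∀ y ∈ Icc x ((1 + δ) * x), 0 < y ∧ y ≤ 2 * x ∧ y < 1 / 2 := by
    intro y hy
    have : (1 + δ) * x ≤ 2 * x := by gcongr; linarith
    exact ⟨hx0.trans_le hy.1, hy.2.trans this, by linarith [hy.2, hx.2]⟩
  have hdiff : ∀ y ∈ Icc x ((1 + δ) * x), y ∈ Ioo 0 π := fun y hy =>
    mem_Ioo_zero_pi_of_mem_Ioo ⟨(hrange y hy).1, by linarith [(hrange y hy).2.2]⟩
  have hquart : ∀ y ∈ Icc x ((1 + δ) * x), ε ≤ κ ^ 2 / 4 * sin (F y) ^ 4 + L := by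
    intro y hy
    have hsub : ∀ z ∈ Icc x y, z ∈ Icc x ((1 + δ) * x) := fun z hz => ⟨hz.1, hz.2.trans hy.2⟩
    have h1 := mul_sub_le_sub_of_hasDerivAt (C := -(M / x)) hy.1
      (fun z hz => hasDerivAt_quartic κ (hF z (hdiff z (hsub z hz))).1) fun z hz => by
        have h2 := hM z ⟨(hrange z (hsub z hz)).1, (hrange z (hsub z hz)).2.2⟩
        have h3 : M / z ≤ M / x := by gcongr; exact hz.1
        exact (neg_le_neg (h2.trans h3)).trans (neg_abs_le _)
    have h2 : M / x * (y - x) ≤ M / x * (δ * x) := by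
      gcongr
      linarith [hy.2]
    have h3 : M / x * (δ * x) = M * δ := by field_simp
    linarith
  have hmain := mul_sub_le_sub_of_hasDerivAt (C := ε ^ 2 / (1 + κ ^ 2) / x)
    (show x ≤ (1 + δ) * x by nlinarith)
    (fun y hy => hasDerivAt_skyrmeEnergy hF hode (hdiff y hy)) fun y hy => by
      obtain ⟨hy0, hy2, hy3⟩ := hrange y hy
      have hy1 : y ∈ Ioo (0 : ℝ) 1 := ⟨hy0, by linarith⟩
      have hs := sin_pos_of_mem_Ioo hy1
      have hsx : sin y ≤ 2 * x := (sin_lt hy0).le.trans hy2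
      refine le_trans ?_ (le_deriv_skyrmeEnergy κ F hy1)
      have hs2 : sin y ^ 2 ≤ ε / 2 := by nlinarith
      have hq := hquart y hy
      have h1 : ε ≤ (1 + κ ^ 2) * (sin y * deriv F y) ^ 2 := by
        linarith [le_mul_sq_slope κ F y, hL y hy1]
      have h2 : 4 * ε ≤ κ ^ 2 * sin (F y) ^ 2 := by
        nlinarith [mul_le_mul_of_nonneg_left (sin_pow_four_le_sin_sq (F y)) (sq_nonneg κ)]
      have h3 : ε / (1 + κ ^ 2) ≤ (sin y * deriv F y) ^ 2 := by
        rw [div_le_iff₀ (by positivity)]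
        linarith
      have h4 : 4 * ε * (ε / (1 + κ ^ 2)) ≤
          κ ^ 2 * sin (F y) ^ 2 * (sin y * deriv F y) ^ 2 :=
        mul_le_mul h2 h3 (by positivity) (by positivity)
      have h5 : 4 * ε * (ε / (1 + κ ^ 2)) = 4 * (ε ^ 2 / (1 + κ ^ 2)) := by ring
      set G := κ ^ 2 / 2 * sin y * sin (F y) ^ 2 * deriv F y ^ 2 with hG
      have hG0 : 0 ≤ G := by positivity
      have h6 : κ ^ 2 * sin (F y) ^ 2 * (sin y * deriv F y) ^ 2 = 2 * (G * sin y) := by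
        rw [hG]
        ring
      rw [div_le_iff₀ hx0]
      nlinarith [mul_le_mul_of_nonneg_left hsx hG0]
  have : ε ^ 2 / (1 + κ ^ 2) / x * ((1 + δ) * x - x) = δ * (ε ^ 2 / (1 + κ ^ 2)) := by
    field_simp
    ring
  linarith

lemma tendsto_quartic {κ : ℝ} {F : ℝ → ℝ} (hF : TwiceDiffOnIoo F)
    (hode : SkyrmeEq κ F) {L : ℝ} (hlim : Tendsto (skyrmeEnergy κ F) (𝓝[>] 0) (𝓝 L))
    (hL : ∀ x ∈ Ioo (0 : ℝ) 1, L ≤ skyrmeEnergy κ F x) (hL0 : L ≤ 0) :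
    Tendsto (fun x => κ ^ 2 / 4 * sin (F x) ^ 4) (𝓝[>] 0) (𝓝 (-L)) := by
  obtain ⟨M, hM0, hM⟩ := exists_deriv_quartic_bound hF hode
  rw [tendsto_order]
  refine ⟨fun a ha => ?_, fun a ha => ?_⟩
  · filter_upwards [hlim.eventually_lt_const (show L < -a by linarith)] with x hx
    linarith [neg_quartic_le_skyrmeEnergy κ F x]
  · obtain ⟨ε, hε, hεa⟩ : ∃ ε, 0 < ε ∧ 2 * ε = a + L := ⟨(a + L) / 2, by linarith, by ring⟩
    obtain ⟨δ, hδ, hδ1, hδM⟩ : ∃ δ, 0 < δ ∧ δ ≤ 1 ∧ M * δ ≤ ε :=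
      ⟨min 1 (ε / M), by positivity, min_le_left _ _, by
        rw [← le_div_iff₀' hM0]
        exact min_le_right _ _⟩
    have hη : 0 < δ * (ε ^ 2 / (1 + κ ^ 2)) := by positivity
    have hscale : Tendsto (fun x : ℝ => (1 + δ) * x) (𝓝[>] 0) (𝓝[>] 0) := by
      refine tendsto_nhdsWithin_iff.2 ⟨?_, ?_⟩
      · exact Tendsto.mono_left (Continuous.tendsto' (by fun_prop) _ _ (by simp))
          nhdsWithin_le_nhds
      · filter_upwards [self_mem_nhdsWithin] with x hx
        have : (0 : ℝ) < x := hx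
        exact mem_Ioi.2 (by positivity)
    have hsq : Tendsto (fun x : ℝ => 8 * x ^ 2) (𝓝[>] 0) (𝓝 0) :=
      Tendsto.mono_left (Continuous.tendsto' (by fun_prop) _ _ (by simp)) nhdsWithin_le_nhds
    filter_upwards [(hlim.comp hscale).eventually_lt_const (lt_add_of_pos_right L hη),
      hsq.eventually_lt_const hε, Ioo_mem_nhdsGT (show (0 : ℝ) < 1 / 4 by norm_num)]
      with x h1 h2 hx
    by_contra! hge
    have hgain := energy_gain_of_quartic hF hode hL hL0 hM hε hδ hδ1 hδM hM0 hx h2.le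
      (by linarith)
    have h1' : skyrmeEnergy κ F ((1 + δ) * x) < L + δ * (ε ^ 2 / (1 + κ ^ 2)) := h1
    linarith [hL x ⟨hx.1, by linarith [hx.2]⟩]

/-- Existence of a boundary limit at the north pole: a solution `F` of the
hedgehog Skyrme ODE on `(0,π)` tends to a finite limit as `ψ → 0⁺`. -/
theorem skyrme_limit_north_pole (κ : ℝ) (hκ : 0 < κ) (F : ℝ → ℝ)
    (hF : TwiceDiffOnIoo F) (hode : SkyrmeEq κ F) :
    ∃ a : ℝ, Filter.Tendsto F (nhdsWithin 0 (Set.Ioi 0)) (nhds a) := by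
  obtain ⟨L, hlim, hL⟩ := exists_tendsto_skyrmeEnergy hF hode
  have hq := tendsto_quartic hF hode hlim hL (skyrmeEnergy_limit_nonpos hκ hF hode hL)
  have hcos : Tendsto (fun x => cos (2 * F x)) (𝓝[>] 0) (𝓝 (1 - 2 * √(4 / κ ^ 2 * -L))) := by
    refine (((hq.const_mul (4 / κ ^ 2)).sqrt.const_mul 2).const_sub 1).congr fun x => ?_
    have h : 4 / κ ^ 2 * (κ ^ 2 / 4 * sin (F x) ^ 4) = (sin (F x) ^ 2) ^ 2 := by
      field_simp
    rw [h, sqrt_sq (sq_nonneg _), cos_two_mul, cos_sq']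
    ring
  exact exists_tendsto_of_tendsto_cos_two_mul pi_pos
    (fun x hx => (hF x hx).1.continuousAt.continuousWithinAt) hcos
end

section
/- Eventual positivity near the pole: let κ > 0 and let F be twice differentiable on (0,π) and solve the hedgehog Skyrme ODE on (0,π), with F(ψ) → 0 as ψ → 0⁺. If there exists a sequence ψₙ → 0⁺ with F(ψₙ) > 0 and F'(ψₙ) > 0 for all n, then there exists ε > 0 such that F(ψ) > 0 and F'(ψ) > 0 for all ψ ∈ (0, ε). -/
open Real Set Filter Topology

/-- If `g > 0` on `[a, b)` and `g b = 0`, then the derivative of `g` at `b` is nonpositive. -/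
theorem HasDerivAt.nonpos_of_pos_left {g : ℝ → ℝ} {g' a b : ℝ} (hab : a < b)
    (hg : HasDerivAt g g' b) (hb : g b = 0) (hpos : ∀ y ∈ Ico a b, 0 < g y) : g' ≤ 0 := by
  have hslope : Tendsto (slope g b) (𝓝[<] b) (𝓝 g') :=
    (hasDerivAt_iff_tendsto_slope.1 hg).mono_left
      (nhdsWithin_mono _ fun y (hy : y < b) => hy.ne)
  refine le_of_tendsto hslope ?_
  filter_upwards [Ico_mem_nhdsLT hab] with y hy
  rw [slope_def_field, hb, sub_zero]
  exact div_nonpos_of_nonneg_of_nonpos (hpos y hy).le (by linarith [hy.2])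

/-- At a critical point where `0 < F < π / 2`, a solution of the Skyrme equation is
strictly convex. -/
theorem SkyrmeEq.deriv_deriv_pos {κ : ℝ} {F : ℝ → ℝ} (hode : SkyrmeEq κ F) {b : ℝ}
    (hb : b ∈ Ioo 0 π) (hF0 : 0 < F b) (hF1 : F b < π / 2) (hcrit : deriv F b = 0) :
    0 < deriv (deriv F) b := by
  have heq := hode b hb
  have hs : 0 < sin b := sin_pos_of_mem_Ioo hb
  have h2 : 0 < sin (2 * F b) := sin_pos_of_pos_of_lt_pi (by linarith) (by linarith)
  have hrhs : 0 ≤ κ ^ 2 / 2 * (sin (F b) ^ 2 / sin b ^ 2) * sin (2 * F b) := by positivity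
  have hcoef : 0 < sin b ^ 2 + κ ^ 2 * sin (F b) ^ 2 := by positivity
  rw [hcrit] at heq
  refine pos_of_mul_pos_right (a := sin b ^ 2 + κ ^ 2 * sin (F b) ^ 2) ?_ hcoef.le
  linarith

/-- Positivity of `F` and `F'` propagates to the right as long as `F < π / 2`. -/
theorem SkyrmeEq.pos_and_deriv_pos {κ : ℝ} {F : ℝ → ℝ} (hF : TwiceDiffOnIoo F)
    (hode : SkyrmeEq κ F) {a c : ℝ} (ha : 0 < a) (hac : a ≤ c) (hc : c < π)
    (hlt : ∀ x ∈ Icc a c, F x < π / 2) (hFa : 0 < F a) (hFa' : 0 < deriv F a) :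
    0 < F c ∧ 0 < deriv F c := by
  have hsub : ∀ x ∈ Icc a c, x ∈ Ioo 0 π := fun x hx =>
    ⟨ha.trans_le hx.1, hx.2.trans_lt hc⟩
  have hmono : ∀ b ∈ Icc a c, (∀ y ∈ Ico a b, 0 < deriv F y) → 0 < F b := by
    intro b hb hpos
    refine hFa.trans_le ((strictMonoOn_of_deriv_pos (convex_Icc a b) ?_ ?_).monotoneOn
      (left_mem_Icc.2 hb.1) (right_mem_Icc.2 hb.1) hb.1)
    · exact fun x hx =>
        (hF x (hsub x ⟨hx.1, hx.2.trans hb.2⟩)).1.continuousAt.continuousWithinAt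
    · intro x hx
      rw [interior_Icc] at hx
      exact hpos x ⟨hx.1.le, hx.2⟩
  have hcont : ContinuousOn (deriv F) (Icc a c) := fun x hx =>
    (hF x (hsub x hx)).2.continuousAt.continuousWithinAt
  have hderiv : ∀ x ∈ Icc a c, 0 < deriv F x := by
    by_contra! hneg
    have hS : IsCompact (Icc a c ∩ deriv F ⁻¹' Iic 0) :=
      isCompact_Icc.of_isClosed_subset
        (hcont.preimage_isClosed_of_isClosed isClosed_Icc isClosed_Iic) inter_subset_left
    obtain ⟨b, ⟨hb, hb0⟩, hmin⟩ := hS.exists_isLeast hneg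
    have hpos : ∀ y ∈ Ico a b, 0 < deriv F y := by
      intro y hy
      by_contra! hy0
      exact hy.2.not_ge (hmin ⟨⟨hy.1, hy.2.le.trans hb.2⟩, hy0⟩)
    have hab : a < b := lt_of_le_of_ne hb.1 (by rintro rfl; exact hFa'.not_ge hb0)
    have hcrit : deriv F b = 0 := by
      have hleft : Tendsto (deriv F) (𝓝[<] b) (𝓝 (deriv F b)) :=
        (hF b (hsub b hb)).2.continuousAt.mono_left nhdsWithin_le_nhds
      refine le_antisymm hb0 (ge_of_tendsto hleft ?_)
      filter_upwards [Ico_mem_nhdsLT hab] with y hy using (hpos y hy).le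
    exact (hode.deriv_deriv_pos (hsub b hb) (hmono b hb hpos) (hlt b hb) hcrit).not_ge
      ((hF b (hsub b hb)).2.hasDerivAt.nonpos_of_pos_left hab hcrit hpos)
  have hcm : c ∈ Icc a c := right_mem_Icc.2 hac
  exact ⟨hmono c hcm fun y hy => hderiv y ⟨hy.1, hy.2.le⟩, hderiv c hcm⟩

/-- Eventual positivity near the pole: if a solution `F` of the hedgehog Skyrme
ODE with `F(ψ) → 0` as `ψ → 0⁺` admits a sequence `ψₙ → 0⁺` with `F(ψₙ) > 0`
and `F'(ψₙ) > 0`, then `F > 0` and `F' > 0` on some interval `(0, ε)`. -/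
theorem skyrme_eventual_positivity (κ : ℝ) (hκ : 0 < κ) (F : ℝ → ℝ)
    (hF : TwiceDiffOnIoo F) (hode : SkyrmeEq κ F)
    (hlim : Filter.Tendsto F (nhdsWithin 0 (Set.Ioi 0)) (nhds 0))
    (ψseq : ℕ → ℝ) (hmem : ∀ n, ψseq n ∈ Set.Ioo (0:ℝ) Real.pi)
    (hto : Filter.Tendsto ψseq Filter.atTop (nhds 0))
    (hpos : ∀ n, 0 < F (ψseq n) ∧ 0 < deriv F (ψseq n)) :
    ∃ ε > 0, ∀ ψ ∈ Set.Ioo (0:ℝ) ε, 0 < F ψ ∧ 0 < deriv F ψ := by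
  have hev : ∀ᶠ x in 𝓝[>] (0 : ℝ), F x < π / 2 := hlim.eventually_lt_const (by positivity)
  obtain ⟨δ, hδ, hlt⟩ := mem_nhdsGT_iff_exists_Ioo_subset.1 hev
  refine ⟨min δ π, lt_min hδ pi_pos, fun ψ hψ => ?_⟩
  obtain ⟨n, hn⟩ := (hto.eventually_lt_const hψ.1).exists
  exact hode.pos_and_deriv_pos hF (hmem n).1 hn.le (hψ.2.trans_le (min_le_right _ _))
    (fun x hx => hlt ⟨(hmem n).1.trans_le hx.1,
      hx.2.trans_lt (hψ.2.trans_le (min_le_left _ _))⟩) (hpos n).1 (hpos n).2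
end

section
/- Upper bound on the logarithmic derivative: let κ > 0 and let F be twice differentiable on (0,π) and solve the hedgehog Skyrme ODE on (0,π), with F(ψ) → 0 as ψ → 0⁺ and with F(ψ) > 0 and F'(ψ) > 0 on some interval (0, ε). Then for all sufficiently small ψ > 0 one has F'(ψ)·sin(2ψ) / (2·F(ψ)) < 1. -/
open Real Set Filter Topology

/-- Where `F ≤ sin ψ · cos ψ · F'`, the Skyrme equation forces `F'' ≤ 0`. Here `x`, `p`, `q`
stand for the values of `F`, `F'`, `F''` at `ψ`. -/
lemma skyrme_second_deriv_nonpos {κ ψ x p q : ℝ} (hψ : ψ ∈ Ioo 0 (π / 2))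
    (hx : x ∈ Ioo 0 (π / 2)) (hp : 0 < p) (hle : x ≤ sin ψ * cos ψ * p)
    (h : (sin ψ ^ 2 + κ ^ 2 * sin x ^ 2) * q + sin (2 * ψ) * p
      + κ ^ 2 / 2 * sin (2 * x) * p ^ 2 - sin (2 * x)
      - κ ^ 2 / 2 * (sin x ^ 2 / sin ψ ^ 2) * sin (2 * x) = 0) : q ≤ 0 := by
  have hs : 0 < sin ψ := sin_pos_of_pos_of_lt_pi hψ.1 (by linarith [hψ.2, pi_pos])
  have hS : 0 < sin x := sin_pos_of_pos_of_lt_pi hx.1 (by linarith [hx.2, pi_pos])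
  have hC : 0 < cos x := cos_pos_of_mem_Ioo ⟨by linarith [hx.1, pi_pos], hx.2⟩
  have hSx : sin x ≤ x := sin_le hx.1.le
  have hSC : sin x * cos x ≤ x := (mul_le_of_le_one_right hS.le (cos_le_one x)).trans hSx
  have hratio : sin x / sin ψ ≤ p := by
    rw [div_le_iff₀ hs]
    nlinarith [mul_le_mul_of_nonneg_left (cos_le_one ψ) (mul_pos hs hp).le]
  have hsq : sin x ^ 2 / sin ψ ^ 2 ≤ p ^ 2 := by
    rw [← div_pow]
    exact pow_le_pow_left₀ (by positivity) hratio 2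
  have hnl : 0 ≤ κ ^ 2 * (sin x * cos x) * (p ^ 2 - sin x ^ 2 / sin ψ ^ 2) :=
    mul_nonneg (by positivity) (sub_nonneg.2 hsq)
  rw [sin_two_mul, sin_two_mul] at h
  have hprod : (sin ψ ^ 2 + κ ^ 2 * sin x ^ 2) * q ≤ 0 := by linarith
  exact nonpos_of_mul_nonpos_right hprod (by positivity)

/-- A function on `(0, δ)` that is bounded above by the identity and strictly decreases
wherever it is nonnegative must be negative. -/
lemma neg_of_deriv_neg_of_nonneg {G G' : ℝ → ℝ} {δ : ℝ}
    (hG : ∀ x ∈ Ioo 0 δ, HasDerivAt G (G' x) x)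
    (hneg : ∀ x ∈ Ioo 0 δ, 0 ≤ G x → G' x < 0)
    (hle : ∀ x ∈ Ioo 0 δ, G x ≤ x) : ∀ x ∈ Ioo 0 δ, G x < 0 := by
  intro b hb
  by_contra! hGb
  have hmem : ∀ x ∈ Ioc 0 b, x ∈ Ioo 0 δ := fun x hx => ⟨hx.1, hx.2.trans_lt hb.2⟩
  have hnonneg : ∀ x ∈ Ioc 0 b, 0 ≤ G x := by
    intro x hx
    have hrefl : ∀ t ∈ Icc (-b) (-x), HasDerivAt (fun t => -G (-t)) (G' (-t)) t := by
      intro t ht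
      have hd := (hG (-t) (hmem _ ⟨by linarith [ht.2, hx.1], by linarith [ht.1]⟩)).scomp t
        (hasDerivAt_neg t)
      exact hd.neg.congr_deriv (by simp)
    have := image_le_of_deriv_right_lt_deriv_boundary (f := fun t => -G (-t))
      (f' := fun t => G' (-t)) (B := fun _ => 0) (B' := fun _ => 0) (a := -b) (b := -x)
      (fun t ht => (hrefl t ht).continuousAt.continuousWithinAt)
      (fun t ht => (hrefl t (Ico_subset_Icc_self ht)).hasDerivWithinAt)
      (by simpa using hGb) (fun t => hasDerivAt_const t 0)
      (fun t ht h0 => hneg _ (hmem _ ⟨by linarith [ht.2, hx.1], by linarith [ht.1]⟩)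
        (by linarith))
      (x := -x) ⟨by linarith [hx.2], le_rfl⟩
    simpa using this
  have hanti : StrictAntiOn G (Ioc 0 b) := by
    apply strictAntiOn_of_deriv_neg (convex_Ioc 0 b)
    · exact fun x hx => (hG x (hmem x hx)).continuousAt.continuousWithinAt
    · intro x hx
      have hx' := interior_subset hx
      rw [(hG x (hmem x hx')).deriv]
      exact hneg x (hmem x hx') (hnonneg x hx')
  have hb0 := hb.1
  have hhalf : b / 2 ∈ Ioc 0 b := ⟨by linarith, by linarith⟩
  have hc : 0 < G (b / 2) :=
    hGb.trans_lt (hanti hhalf ⟨hb0, le_rfl⟩ (by linarith))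
  have hy : G (b / 2) / 2 ∈ Ioc 0 b :=
    ⟨by linarith, by linarith [hle _ (hmem _ hhalf)]⟩
  have hlt := hanti hy hhalf (by linarith [hle _ (hmem _ hhalf)])
  linarith [hle _ (hmem _ hy)]

/-- Upper bound on the logarithmic derivative: for a solution `F` of the
hedgehog Skyrme ODE with `F → 0` at `0⁺`, positive with positive derivative
near `0`, one has `F'(ψ)·sin(2ψ)/(2·F(ψ)) < 1` for all sufficiently small `ψ > 0`. -/
theorem skyrme_log_deriv_upper (κ : ℝ) (hκ : 0 < κ) (F : ℝ → ℝ)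
    (hF : TwiceDiffOnIoo F) (hode : SkyrmeEq κ F)
    (hlim : Filter.Tendsto F (nhdsWithin 0 (Set.Ioi 0)) (nhds 0))
    (ε : ℝ) (hε : 0 < ε)
    (hpos : ∀ ψ ∈ Set.Ioo (0:ℝ) ε, 0 < F ψ ∧ 0 < deriv F ψ) :
    ∀ᶠ ψ in nhdsWithin 0 (Set.Ioi (0:ℝ)),
      deriv F ψ * Real.sin (2 * ψ) / (2 * F ψ) < 1 := by
  have hsmall : ∀ᶠ ψ in 𝓝[>] (0:ℝ), F ψ < π / 2 :=
    hlim.eventually (gt_mem_nhds (by positivity))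
  obtain ⟨η, hη, hFη⟩ := mem_nhdsGT_iff_exists_Ioo_subset.1 hsmall
  have hη' : 0 < η := hη
  set δ := min (min ε η) (π / 2)
  have hδ0 : 0 < δ := by positivity
  have hδε : δ ≤ ε := (min_le_left _ _).trans (min_le_left _ _)
  have hδη : δ ≤ η := (min_le_left _ _).trans (min_le_right _ _)
  have hδπ : δ ≤ π / 2 := min_le_right _ _
  have hkey : ∀ ψ ∈ Ioo 0 δ, sin ψ * cos ψ - F ψ / deriv F ψ < 0 := by
    apply neg_of_deriv_neg_of_nonneg
      (G' := fun ψ => (cos ψ * cos ψ + sin ψ * -sin ψ)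
        - (deriv F ψ * deriv F ψ - F ψ * deriv (deriv F) ψ) / deriv F ψ ^ 2)
    · intro ψ hψ
      obtain ⟨hd, hd'⟩ := hF ψ ⟨hψ.1, by linarith [hψ.2, pi_pos]⟩
      exact ((hasDerivAt_sin ψ).mul (hasDerivAt_cos ψ) |>.congr_deriv (by ring)).sub
        (hd.hasDerivAt.div hd'.hasDerivAt (hpos ψ ⟨hψ.1, hψ.2.trans_le hδε⟩).2.ne')
    · intro ψ hψ hG
      obtain ⟨hF0, hp⟩ := hpos ψ ⟨hψ.1, hψ.2.trans_le hδε⟩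
      have hlt : F ψ < π / 2 := hFη ⟨hψ.1, hψ.2.trans_le hδη⟩
      have hs : 0 < sin ψ := sin_pos_of_pos_of_lt_pi hψ.1 (by linarith [hψ.2, pi_pos])
      have hq : deriv (deriv F) ψ ≤ 0 :=
        skyrme_second_deriv_nonpos ⟨hψ.1, hψ.2.trans_le hδπ⟩ ⟨hF0, hlt⟩ hp
          ((div_le_iff₀ hp).1 (by linarith)) (hode ψ ⟨hψ.1, by linarith [hψ.2, pi_pos]⟩)
      have hquot : F ψ * deriv (deriv F) ψ / deriv F ψ ^ 2 ≤ 0 :=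
        div_nonpos_of_nonpos_of_nonneg (mul_nonpos_of_nonneg_of_nonpos hF0.le hq) (by positivity)
      have hsplit : (deriv F ψ * deriv F ψ - F ψ * deriv (deriv F) ψ) / deriv F ψ ^ 2
          = 1 - F ψ * deriv (deriv F) ψ / deriv F ψ ^ 2 := by
        field_simp
      simp only [hsplit]
      nlinarith [sin_sq_add_cos_sq ψ]
    · intro ψ hψ
      obtain ⟨hF0, hp⟩ := hpos ψ ⟨hψ.1, hψ.2.trans_le hδε⟩
      have hs : 0 < sin ψ := sin_pos_of_pos_of_lt_pi hψ.1 (by linarith [hψ.2, pi_pos])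
      have := div_pos hF0 hp
      linarith [sin_le hψ.1.le, mul_le_of_le_one_right hs.le (cos_le_one ψ)]
  filter_upwards [Ioo_mem_nhdsGT hδ0] with ψ hψ
  obtain ⟨hF0, hp⟩ := hpos ψ ⟨hψ.1, hψ.2.trans_le hδε⟩
  have hlt := (lt_div_iff₀ hp).1 (sub_neg.1 (hkey ψ hψ))
  rw [div_lt_one (by positivity), sin_two_mul]
  linarith
end

section
/- Lower bound on the logarithmic derivative: let κ > 0 and let F be twice differentiable on (0,π) and solve the hedgehog Skyrme ODE on (0,π), with F(ψ) → 0 as ψ → 0⁺ and with F(ψ) > 0 and F'(ψ) > 0 on some interval (0, ε). Then for all sufficiently small ψ > 0 one has 2·F'(ψ)·tan(ψ) / sin(2F(ψ)) > 1. -/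
open Real Set Filter Topology

/-- A function on `(0, b]` whose derivative is negative wherever it is nonnegative, and which is
nonnegative at `b`, is bounded below by a positive constant near `0`. -/
lemma exists_pos_lower_bound_of_deriv_neg {K K' : ℝ → ℝ} {b : ℝ} (hb : 0 < b)
    (hK : ∀ x ∈ Ioc 0 b, HasDerivAt K (K' x) x)
    (hneg : ∀ x ∈ Ioc 0 b, 0 ≤ K x → K' x < 0) (hKb : 0 ≤ K b) :
    ∃ m > 0, ∀ x ∈ Ioo 0 (b / 2), m ≤ K x := by
  have hnonneg : ∀ x ∈ Ioc 0 b, 0 ≤ K x := by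
    intro x hx
    have hmem : ∀ t ∈ Icc (-b) (-x), -t ∈ Ioc 0 b := fun t ht =>
      ⟨by linarith [ht.2, hx.1], by linarith [ht.1]⟩
    have hderiv : ∀ t ∈ Icc (-b) (-x), HasDerivAt (fun t => -K (-t)) (K' (-t)) t := by
      intro t ht
      have h := ((hK (-t) (hmem t ht)).comp t (hasDerivAt_neg t)).neg
      exact h.congr_deriv (by ring)
    have h := image_le_of_deriv_right_lt_deriv_boundary' (f := fun t => -K (-t))
      (f' := fun t => K' (-t)) (a := -b) (b := -x) (B := fun _ => 0) (B' := fun _ => 0)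
      (fun t ht => (hderiv t ht).continuousAt.continuousWithinAt)
      (fun t ht => (hderiv t (Ico_subset_Icc_self ht)).hasDerivWithinAt)
      (by simpa using hKb) continuousOn_const (fun t _ => hasDerivWithinAt_const _ _ _)
      (fun t ht h0 => hneg _ (hmem t (Ico_subset_Icc_self ht)) (by linarith))
      (x := -x) ⟨by linarith [hx.2], le_rfl⟩
    simpa using h
  have hanti : StrictAntiOn K (Ioc 0 b) := by
    refine strictAntiOn_of_deriv_neg (convex_Ioc 0 b)
      (fun x hx => (hK x hx).continuousAt.continuousWithinAt) fun x hx => ?_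
    have hx' := interior_subset hx
    rw [(hK x hx').deriv]
    exact hneg x hx' (hnonneg x hx')
  have hmid : b / 2 ∈ Ioc 0 b := ⟨by linarith, by linarith⟩
  refine ⟨K (b / 2), ?_, fun x hx => ?_⟩
  · exact hKb.trans_lt (hanti hmid ⟨hb, le_rfl⟩ (by linarith))
  · exact (hanti ⟨hx.1, by linarith [hx.2]⟩ hmid hx.2).le

/-- The algebraic heart of the estimate. Here `s, c, S, C` stand for `sin ψ, cos ψ, sin F, cos F`,
`g` for the logarithmic derivative `F' tan ψ / (sin F cos F)`, `q` for `F''`, and `r` for the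
quantity `sin ψ cos ψ g'`. -/
lemma one_sub_lt_of_skyrme_of_le_one {κ s c S C g q r : ℝ} (hs : 0 < s) (hc : 0 < c)
    (hS : 0 < S) (hC : 0 < C) (hsc : s ^ 2 + c ^ 2 = 1) (hSC : S ^ 2 + C ^ 2 = 1)
    (hg : 0 < g) (hg1 : g ≤ 1)
    (hode : (s ^ 2 + κ ^ 2 * S ^ 2) * q + 2 * s * c * (g * S * C * c / s)
      + κ ^ 2 / 2 * (2 * S * C) * (g * S * C * c / s) ^ 2 - 2 * S * C
      - κ ^ 2 / 2 * (S ^ 2 / s ^ 2) * (2 * S * C) = 0)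
    (hr : r = s ^ 2 * q / (S * C) + g - c ^ 2 * (C ^ 2 - S ^ 2) * g ^ 2) :
    1 - g < r := by
  have hq : q = S * C / s ^ 2 * (r - g + c ^ 2 * (C ^ 2 - S ^ 2) * g ^ 2) := by
    rw [hr]; field_simp; ring
  obtain ⟨k, hk⟩ : ∃ k, k = κ ^ 2 * S ^ 2 / s ^ 2 := ⟨_, rfl⟩
  have hk0 : 0 ≤ k := by rw [hk]; positivity
  have hκ : κ ^ 2 = k * s ^ 2 / S ^ 2 := by rw [hk]; field_simp
  rw [hq, hκ] at hode
  have key : (1 + k) * r = 2 + g - 2 * c ^ 2 * g - c ^ 2 * (C ^ 2 - S ^ 2) * g ^ 2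
      + k * (1 + g - c ^ 2 * (C ^ 2 - S ^ 2) * g ^ 2 - C ^ 2 * c ^ 2 * g ^ 2) := by
    field_simp at hode
    rcases mul_eq_zero.1 hode with h | h
    · exact absurd h (by positivity)
    · linear_combination h
  have hgg : g ^ 2 ≤ g := by nlinarith
  have hcC : c ^ 2 * C ^ 2 ≤ 1 := by
    exact mul_le_one₀ (by linarith [sq_nonneg s]) (sq_nonneg C) (by linarith [sq_nonneg S])
  have hcCg : c ^ 2 * C ^ 2 * g ^ 2 ≤ g ^ 2 :=
    mul_le_of_le_one_left (sq_nonneg g) hcC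
  have hcSg : 0 < c ^ 2 * S ^ 2 * g ^ 2 := by positivity
  have hsg : 0 < s ^ 2 * g := by positivity
  have h₁ : 1 - g < 2 + g - 2 * c ^ 2 * g - c ^ 2 * (C ^ 2 - S ^ 2) * g ^ 2 := by
    have : c ^ 2 * g = g - s ^ 2 * g := by linear_combination g * hsc
    linarith
  have h₂ : 1 - g ≤ 1 + g - c ^ 2 * (C ^ 2 - S ^ 2) * g ^ 2 - C ^ 2 * c ^ 2 * g ^ 2 := by
    linarith
  have h₃ := mul_le_mul_of_nonneg_left h₂ hk0
  have : (1 + k) * (1 - g) < (1 + k) * r := by rw [key]; linarith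
  exact lt_of_mul_lt_mul_left this (by linarith)

/-- Lower bound on the logarithmic derivative: for a solution `F` of the
hedgehog Skyrme ODE with `F → 0` at `0⁺`, positive with positive derivative
near `0`, one has `2·F'(ψ)·tan(ψ)/sin(2F(ψ)) > 1` for all sufficiently small `ψ > 0`. -/
theorem skyrme_log_deriv_lower (κ : ℝ) (hκ : 0 < κ) (F : ℝ → ℝ)
    (hF : TwiceDiffOnIoo F) (hode : SkyrmeEq κ F)
    (hlim : Filter.Tendsto F (nhdsWithin 0 (Set.Ioi 0)) (nhds 0))
    (ε : ℝ) (hε : 0 < ε)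
    (hpos : ∀ ψ ∈ Set.Ioo (0:ℝ) ε, 0 < F ψ ∧ 0 < deriv F ψ) :
    ∀ᶠ ψ in nhdsWithin 0 (Set.Ioi (0:ℝ)),
      1 < 2 * deriv F ψ * Real.tan ψ / Real.sin (2 * F ψ) := by
  have hsmall : ∀ᶠ ψ in 𝓝[>] (0:ℝ), F ψ < π / 2 ∧ ψ ∈ Ioo 0 ε ∧ ψ ∈ Ioo 0 (π / 2) :=
    (hlim.eventually_lt_const (by positivity)).and
      (Filter.Eventually.and (Ioo_mem_nhdsGT hε) (Ioo_mem_nhdsGT (by positivity)))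
  obtain ⟨δ, hδ, hδsub⟩ := mem_nhdsGT_iff_exists_Ioo_subset.1 hsmall
  set G : ℝ → ℝ := fun ψ => 2 * deriv F ψ * Real.tan ψ / Real.sin (2 * F ψ) with hG
  filter_upwards [Ioo_mem_nhdsGT hδ] with b hb
  by_contra! hGb
  have htrig : ∀ ψ ∈ Ioc 0 b, 0 < sin ψ ∧ 0 < cos ψ ∧ 0 < sin (F ψ) ∧ 0 < cos (F ψ) ∧
      0 < deriv F ψ ∧ ψ ∈ Ioo 0 π := by
    intro ψ hψ
    obtain ⟨hFs, hψε, hψπ⟩ := hδsub ⟨hψ.1, hψ.2.trans_lt hb.2⟩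
    obtain ⟨hF0, hF'⟩ := hpos ψ hψε
    have hπ := pi_pos
    exact ⟨sin_pos_of_pos_of_lt_pi hψ.1 (by linarith [hψπ.2]),
      cos_pos_of_mem_Ioo ⟨by linarith [hψ.1], hψπ.2⟩,
      sin_pos_of_pos_of_lt_pi hF0 (by linarith), cos_pos_of_mem_Ioo ⟨by linarith, hFs⟩, hF',
      hψ.1, by linarith [hψπ.2]⟩
  have hGpos : ∀ ψ ∈ Ioc 0 b, 0 < G ψ := by
    intro ψ hψ
    obtain ⟨hs, hc, hS, hC, hF', -⟩ := htrig ψ hψ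
    simp only [hG, tan_eq_sin_div_cos, sin_two_mul]
    positivity
  set G' : ℝ → ℝ := fun ψ =>
    (sin ψ ^ 2 * deriv (deriv F) ψ / (sin (F ψ) * cos (F ψ)) + G ψ
      - cos ψ ^ 2 * (cos (F ψ) ^ 2 - sin (F ψ) ^ 2) * G ψ ^ 2) / (sin ψ * cos ψ) with hG'
  have hGderiv : ∀ ψ ∈ Ioc 0 b, HasDerivAt G (G' ψ) ψ := by
    intro ψ hψ
    obtain ⟨hs, hc, hS, hC, hF', hψπ⟩ := htrig ψ hψ
    obtain ⟨hd, hdd⟩ := hF ψ hψπ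
    have hden : sin (2 * F ψ) ≠ 0 := by rw [sin_two_mul]; positivity
    have h := ((hdd.hasDerivAt.const_mul 2).mul (hasDerivAt_tan hc.ne')).div
      (hd.hasDerivAt.const_mul 2).sin hden
    refine h.congr_deriv ?_
    simp only [hG', hG, Pi.mul_apply, tan_eq_sin_div_cos, sin_two_mul, cos_two_mul']
    field_simp
  have hKderiv : ∀ ψ ∈ Ioc 0 b, HasDerivAt (fun ψ => (1 - G ψ) * tan ψ)
      (-G' ψ * tan ψ + (1 - G ψ) * (1 / cos ψ ^ 2)) ψ := fun ψ hψ =>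
    ((hGderiv ψ hψ).const_sub 1).mul (hasDerivAt_tan (htrig ψ hψ).2.1.ne')
  have htan : ∀ ψ ∈ Ioc 0 b, 0 < tan ψ := fun ψ hψ => by
    rw [tan_eq_sin_div_cos]
    exact div_pos (htrig ψ hψ).1 (htrig ψ hψ).2.1
  obtain ⟨m, hm, hmK⟩ := exists_pos_lower_bound_of_deriv_neg hb.1 hKderiv
    (by
      intro ψ hψ hK
      have hG1 : G ψ ≤ 1 := sub_nonneg.1 (nonneg_of_mul_nonneg_left hK (htan ψ hψ))
      obtain ⟨hs, hc, hS, hC, hF', hψπ⟩ := htrig ψ hψ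
      have hp : deriv F ψ = G ψ * sin (F ψ) * cos (F ψ) * cos ψ / sin ψ := by
        simp only [hG, tan_eq_sin_div_cos, sin_two_mul]
        field_simp
      have h := hode ψ hψπ
      rw [hp, sin_two_mul, sin_two_mul] at h
      have hlt := one_sub_lt_of_skyrme_of_le_one (r := sin ψ * cos ψ * G' ψ) hs hc hS hC
        (sin_sq_add_cos_sq ψ) (sin_sq_add_cos_sq (F ψ)) (hGpos ψ hψ) hG1 h
        (by simp only [hG']; field_simp)
      have heq : -G' ψ * tan ψ + (1 - G ψ) * (1 / cos ψ ^ 2)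
          = (1 - G ψ - sin ψ * cos ψ * G' ψ) / cos ψ ^ 2 := by
        rw [tan_eq_sin_div_cos]; field_simp; ring
      rw [heq]
      exact div_neg_of_neg_of_pos (by linarith) (by positivity))
    (mul_nonneg (sub_nonneg.2 hGb) (htan b ⟨hb.1, le_rfl⟩).le)
  have htan0 : Tendsto tan (𝓝[>] (0:ℝ)) (𝓝 0) := by
    have h : ContinuousAt tan 0 := continuousAt_tan.2 (by simp)
    simpa [ContinuousAt] using h.mono_left nhdsWithin_le_nhds
  obtain ⟨x, hxm, hx⟩ := ((htan0.eventually_lt_const hm).and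
    (Ioo_mem_nhdsGT (half_pos hb.1))).exists
  have hxb : x ∈ Ioc 0 b := ⟨hx.1, by linarith [hx.2, hb.1]⟩
  have hGx := mul_pos (hGpos x hxb) (htan x hxb)
  linarith [hmK x hx]
end

section
/- Two-sided derivative bound: let κ > 0 and let F be twice differentiable on (0,π) and solve the hedgehog Skyrme ODE on (0,π), with F(ψ) → 0 as ψ → 0⁺ and with F(ψ) > 0 and F'(ψ) > 0 on some interval (0, ε). Then for all sufficiently small ψ > 0 one has sin(2F(ψ)) / (2·tan(ψ)) < F'(ψ) < 2·F(ψ) / sin(2ψ). -/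
open Real Set Filter Topology

/-- If `f` decreases strictly wherever it is nonnegative on `(0, a]` and `0 ≤ f a`, then `f` is
bounded below by a positive constant near `0⁺`. -/
lemma exists_pos_le_of_deriv_neg_of_nonneg {f f' : ℝ → ℝ} {a : ℝ} (ha : 0 < a)
    (hd : ∀ x ∈ Ioc 0 a, HasDerivAt f (f' x) x)
    (hneg : ∀ x ∈ Ioc 0 a, 0 ≤ f x → f' x < 0) (hfa : 0 ≤ f a) :
    ∃ δ > 0, ∃ b ∈ Ioc 0 a, ∀ x ∈ Ioo 0 b, δ ≤ f x := by
  have hcont : ContinuousOn f (Ioc 0 a) := fun x hx => (hd x hx).continuousAt.continuousWithinAt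
  have hnonneg : ∀ y ∈ Ioc 0 a, 0 ≤ f y := by
    intro y hy
    obtain ⟨z, hz, hmax⟩ := isCompact_Icc.exists_isMaxOn (nonempty_Icc.2 hy.2)
      (hcont.mono fun x hx => ⟨hy.1.trans_le hx.1, hx.2⟩)
    have hfz : 0 ≤ f z := hfa.trans (hmax (right_mem_Icc.2 hy.2))
    rcases hz.1.eq_or_lt with rfl | hyz
    · exact hfz
    have hz' : z ∈ Ioc 0 a := ⟨hy.1.trans hyz, hz.2⟩
    have hslope : ∀ᶠ x in 𝓝[<] z, slope f z x < 0 :=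
      (((hd z hz').tendsto_slope).mono_left
        (nhdsWithin_mono _ fun x (hx : x < z) => hx.ne)).eventually_lt_const (hneg z hz' hfz)
    obtain ⟨x, hx, hxI⟩ := (hslope.and (Ioo_mem_nhdsLT hyz)).exists
    have hle : f x ≤ f z := hmax ⟨hxI.1.le, hxI.2.le.trans hz.2⟩
    rw [slope_def_field] at hx
    exact absurd hx (not_lt.2 (div_nonneg_of_nonpos (by linarith) (by linarith [hxI.2])))
  have hanti : StrictAntiOn f (Ioc 0 a) := by
    refine strictAntiOn_of_deriv_neg (convex_Ioc 0 a) hcont fun x hx => ?_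
    have hx' := interior_subset hx
    rw [(hd x hx').deriv]
    exact hneg x hx' (hnonneg x hx')
  have hmid : a / 2 ∈ Ioc 0 a := ⟨by linarith, by linarith⟩
  refine ⟨f (a / 2), hfa.trans_lt (hanti hmid ⟨ha, le_rfl⟩ (by linarith)), a / 2, hmid,
    fun x hx => (hanti ⟨hx.1, hx.2.le.trans hmid.2⟩ hmid hx.2).le⟩

/-- A function that is positive near `0⁺` cannot satisfy `δ / x ≤ f'` there with `δ > 0`. -/
lemma not_forall_div_le_deriv {f f' : ℝ → ℝ} {b δ : ℝ} (hb : 0 < b) (hδ : 0 < δ)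
    (hd : ∀ x ∈ Ioo 0 b, HasDerivAt f (f' x) x) (hf : ∀ x ∈ Ioo 0 b, 0 < f x) :
    ¬ ∀ x ∈ Ioo 0 b, δ / x ≤ f' x := by
  intro h
  have hdg : ∀ x ∈ Ioo 0 b, HasDerivAt (fun x => f x - δ * log x) (f' x - δ * x⁻¹) x :=
    fun x hx => (hd x hx).sub ((hasDerivAt_log hx.1.ne').const_mul δ)
  have hmono : MonotoneOn (fun x => f x - δ * log x) (Ioo 0 b) := by
    refine monotoneOn_of_deriv_nonneg (convex_Ioo 0 b)
      (fun x hx => (hdg x hx).continuousAt.continuousWithinAt)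
      (fun x hx => (hdg x (interior_subset hx)).differentiableAt.differentiableWithinAt)
      fun x hx => ?_
    rw [(hdg x (interior_subset hx)).deriv, ← div_eq_mul_inv]
    exact sub_nonneg.2 (h x (interior_subset hx))
  have hmid : b / 2 ∈ Ioo 0 b := ⟨by linarith, by linarith⟩
  obtain ⟨x, hlog, hx⟩ := ((tendsto_log_nhdsGT_zero.eventually_lt_atBot
    (-(f (b / 2) - δ * log (b / 2)) / δ)).and (Ioo_mem_nhdsGT hmid.1)).exists
  have hxb : x ∈ Ioo 0 b := ⟨hx.1, hx.2.trans hmid.2⟩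
  have hle := hmono hxb hmid hx.2.le
  have hfx := hf x hxb
  rw [lt_div_iff₀ hδ] at hlog
  simp only at hle
  linarith

/-- The hedgehog Skyrme ODE solved for the second-order term. -/
lemma SkyrmeEq.mul_deriv_deriv {κ : ℝ} {F : ℝ → ℝ} (h : SkyrmeEq κ F) {x : ℝ}
    (hx : x ∈ Ioo 0 π) :
    (sin x ^ 2 + κ ^ 2 * sin (F x) ^ 2) * deriv (deriv F) x =
      2 * (sin (F x) * cos (F x) - sin x * cos x * deriv F x) +
        κ ^ 2 * (sin (F x) * cos (F x)) * ((sin (F x) / sin x) ^ 2 - deriv F x ^ 2) := by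
  have h := h x hx
  rw [sin_two_mul, sin_two_mul] at h
  rw [div_pow]
  linear_combination h

/-- A solution is strictly concave at points where `F' ≥ 2 F / sin 2ψ`. -/
lemma SkyrmeEq.deriv_deriv_neg {κ : ℝ} {F : ℝ → ℝ} (h : SkyrmeEq κ F) {x : ℝ}
    (hx : x ∈ Ioo 0 (π / 2)) (hFx : F x ∈ Ioo 0 (π / 2))
    (hle : F x ≤ sin x * cos x * deriv F x) : deriv (deriv F) x < 0 := by
  have hs : 0 < sin x := sin_pos_of_pos_of_lt_pi hx.1 (by linarith [hx.2, pi_pos])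
  have hc : 0 < cos x := cos_pos_of_mem_Ioo ⟨by linarith [hx.1, pi_pos], hx.2⟩
  have hS : 0 < sin (F x) := sin_pos_of_pos_of_lt_pi hFx.1 (by linarith [hFx.2, pi_pos])
  have hC : 0 < cos (F x) := cos_pos_of_mem_Ioo ⟨by linarith [hFx.1, pi_pos], hFx.2⟩
  have heq := h.mul_deriv_deriv ⟨hx.1, by linarith [hx.2, pi_pos]⟩
  have hSF : sin (F x) < F x := sin_lt hFx.1
  have hSC : sin (F x) * cos (F x) ≤ sin (F x) := mul_le_of_le_one_right hS.le (cos_le_one _)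
  have hF' : 0 < deriv F x := pos_of_mul_pos_right (hFx.1.trans_le hle) (by positivity)
  have hratio : sin (F x) / sin x ≤ deriv F x := by
    rw [div_le_iff₀ hs]
    nlinarith [mul_le_of_le_one_right (mul_pos hs hF').le (cos_le_one x)]
  have hsq : (sin (F x) / sin x) ^ 2 ≤ deriv F x ^ 2 := by gcongr
  have hlast : κ ^ 2 * (sin (F x) * cos (F x)) * ((sin (F x) / sin x) ^ 2 - deriv F x ^ 2) ≤ 0 :=
    mul_nonpos_of_nonneg_of_nonpos (by positivity) (by linarith)
  refine neg_of_mul_neg_right (a := sin x ^ 2 + κ ^ 2 * sin (F x) ^ 2) ?_ (by positivity)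
  linarith

/-- A solution is strictly convex at points where `0 < F' ≤ sin 2F / (2 tan ψ)`. -/
lemma SkyrmeEq.deriv_deriv_pos_s15 {κ : ℝ} {F : ℝ → ℝ} (h : SkyrmeEq κ F) {x : ℝ}
    (hx : x ∈ Ioo 0 (π / 2)) (hFx : F x ∈ Ioo 0 (π / 2)) (hF' : 0 < deriv F x)
    (hle : sin x * deriv F x ≤ sin (F x) * cos (F x) * cos x) : 0 < deriv (deriv F) x := by
  have hs : 0 < sin x := sin_pos_of_pos_of_lt_pi hx.1 (by linarith [hx.2, pi_pos])
  have hc : 0 < cos x := cos_pos_of_mem_Ioo ⟨by linarith [hx.1, pi_pos], hx.2⟩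
  have hS : 0 < sin (F x) := sin_pos_of_pos_of_lt_pi hFx.1 (by linarith [hFx.2, pi_pos])
  have hC : 0 < cos (F x) := cos_pos_of_mem_Ioo ⟨by linarith [hFx.1, pi_pos], hFx.2⟩
  have heq := h.mul_deriv_deriv ⟨hx.1, by linarith [hx.2, pi_pos]⟩
  have hSC : sin (F x) * cos (F x) ≤ sin (F x) := mul_le_of_le_one_right hS.le (cos_le_one _)
  have hSCc : sin (F x) * cos (F x) * cos x ≤ sin (F x) * cos (F x) :=
    mul_le_of_le_one_right (by positivity) (cos_le_one _)
  have hc1 : cos x < 1 := by nlinarith [sin_sq_add_cos_sq x]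
  have hfirst : sin x * cos x * deriv F x < sin (F x) * cos (F x) := by
    nlinarith [mul_lt_mul_of_pos_left hc1 (mul_pos hs hF')]
  have hratio : deriv F x ≤ sin (F x) / sin x := by
    rw [le_div_iff₀ hs]
    linarith
  have hsq : deriv F x ^ 2 ≤ (sin (F x) / sin x) ^ 2 := by gcongr
  have hlast : 0 ≤ κ ^ 2 * (sin (F x) * cos (F x)) * ((sin (F x) / sin x) ^ 2 - deriv F x ^ 2) :=
    mul_nonneg (by positivity) (by linarith)
  refine pos_of_mul_pos_right (a := sin x ^ 2 + κ ^ 2 * sin (F x) ^ 2) ?_ (by positivity)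
  linarith

/-- Upper bound: `sin ψ cos ψ F' < F` wherever `F` stays in `(0, π/2)` down to `0`. -/
lemma SkyrmeEq.sin_mul_cos_mul_deriv_lt {κ : ℝ} {F : ℝ → ℝ} (h : SkyrmeEq κ F)
    (hF : TwiceDiffOnIoo F) {a : ℝ} (ha : a ∈ Ioo 0 (π / 2))
    (hFa : ∀ x ∈ Ioc 0 a, F x ∈ Ioo 0 (π / 2)) (hF' : ∀ x ∈ Ioc 0 a, 0 < deriv F x) :
    sin a * cos a * deriv F a < F a := by
  by_contra! hcon
  have hI : ∀ x ∈ Ioc 0 a, x ∈ Ioo 0 (π / 2) := fun x hx => ⟨hx.1, hx.2.trans_lt ha.2⟩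
  have hdiff : ∀ x ∈ Ioc 0 a, DifferentiableAt ℝ F x ∧ DifferentiableAt ℝ (deriv F) x :=
    fun x hx => hF x ⟨hx.1, by linarith [(hI x hx).2, pi_pos]⟩
  obtain ⟨δ, hδ, b, hb, hle⟩ := exists_pos_le_of_deriv_neg_of_nonneg
    (f := fun x => sin x * cos x * deriv F x - F x)
    (f' := fun x => sin x * cos x * deriv (deriv F) x - 2 * sin x ^ 2 * deriv F x) ha.1
    (fun x hx => by
      have hd := (((hasDerivAt_sin x).mul (hasDerivAt_cos x)).mul
        (hdiff x hx).2.hasDerivAt).sub (hdiff x hx).1.hasDerivAt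
      refine hd.congr_deriv ?_
      simp only [Pi.mul_apply]
      linear_combination deriv F x * sin_sq_add_cos_sq x)
    (fun x hx hnonneg => by
      have hs : 0 < sin x := sin_pos_of_pos_of_lt_pi hx.1 (by linarith [(hI x hx).2, pi_pos])
      have hc : 0 < cos x := cos_pos_of_mem_Ioo ⟨by linarith [hx.1, pi_pos], (hI x hx).2⟩
      have hF'' := h.deriv_deriv_neg (hI x hx) (hFa x hx) (sub_nonneg.1 hnonneg)
      have := mul_neg_of_pos_of_neg (mul_pos hs hc) hF''
      have := mul_pos (pow_pos hs 2) (hF' x hx)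
      linarith)
    (sub_nonneg.2 hcon)
  have hsub : ∀ x ∈ Ioo 0 b, x ∈ Ioc 0 a := fun x hx => ⟨hx.1, hx.2.le.trans hb.2⟩
  refine not_forall_div_le_deriv hb.1 hδ (fun x hx => (hdiff x (hsub x hx)).1.hasDerivAt)
    (fun x hx => (hFa x (hsub x hx)).1) fun x hx => ?_
  have hs : 0 < sin x :=
    sin_pos_of_pos_of_lt_pi hx.1 (by linarith [(hI x (hsub x hx)).2, pi_pos])
  have hscx : sin x * cos x ≤ x :=
    (mul_le_of_le_one_right hs.le (cos_le_one x)).trans (sin_le hx.1.le)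
  have hmul := mul_le_mul_of_nonneg_right hscx (hF' x (hsub x hx)).le
  have hlex := hle x hx
  have hFx := (hFa x (hsub x hx)).1
  rw [div_le_iff₀ hx.1]
  linarith

/-- Lower bound: `sin F cos F cos ψ < sin ψ F'` wherever `F` stays in `(0, π/2)` with `F' > 0` down
to `0`, provided `F → 0` at `0⁺`. -/
lemma SkyrmeEq.lt_sin_mul_deriv {κ : ℝ} {F : ℝ → ℝ} (h : SkyrmeEq κ F)
    (hF : TwiceDiffOnIoo F) (hlim : Tendsto F (𝓝[>] 0) (𝓝 0)) {a : ℝ} (ha : a ∈ Ioo 0 (π / 2))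
    (hFa : ∀ x ∈ Ioc 0 a, F x ∈ Ioo 0 (π / 2)) (hF' : ∀ x ∈ Ioc 0 a, 0 < deriv F x) :
    sin (F a) * cos (F a) * cos a < sin a * deriv F a := by
  by_contra! hcon
  have hI : ∀ x ∈ Ioc 0 a, x ∈ Ioo 0 (π / 2) := fun x hx => ⟨hx.1, hx.2.trans_lt ha.2⟩
  have hdiff : ∀ x ∈ Ioc 0 a, DifferentiableAt ℝ F x ∧ DifferentiableAt ℝ (deriv F) x :=
    fun x hx => hF x ⟨hx.1, by linarith [(hI x hx).2, pi_pos]⟩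
  have hsin : ∀ x ∈ Ioc 0 a, 0 < sin x := fun x hx =>
    sin_pos_of_pos_of_lt_pi hx.1 (by linarith [(hI x hx).2, pi_pos])
  have hcos : ∀ x ∈ Ioc 0 a, 0 < cos x := fun x hx =>
    cos_pos_of_mem_Ioo ⟨by linarith [hx.1, pi_pos], (hI x hx).2⟩
  have hsinF : ∀ x ∈ Ioc 0 a, 0 < sin (F x) := fun x hx =>
    sin_pos_of_pos_of_lt_pi (hFa x hx).1 (by linarith [(hFa x hx).2, pi_pos])
  have hcosF : ∀ x ∈ Ioc 0 a, 0 < cos (F x) := fun x hx =>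
    cos_pos_of_mem_Ioo ⟨by linarith [(hFa x hx).1, pi_pos], (hFa x hx).2⟩
  obtain ⟨δ, hδ, b, hb, hle⟩ := exists_pos_le_of_deriv_neg_of_nonneg
    (f := fun x => sin (F x) * cos (F x) * cos x - sin x * deriv F x)
    (f' := fun x => -(sin x * deriv (deriv F) x + 2 * sin (F x) ^ 2 * cos x * deriv F x
      + sin (F x) * cos (F x) * sin x)) ha.1
    (fun x hx => by
      have hFd := (hdiff x hx).1.hasDerivAt
      have hd := ((hFd.sin.mul hFd.cos).mul (hasDerivAt_cos x)).sub
        ((hasDerivAt_sin x).mul (hdiff x hx).2.hasDerivAt)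
      refine hd.congr_deriv ?_
      simp only [Pi.mul_apply]
      linear_combination cos x * deriv F x * sin_sq_add_cos_sq (F x))
    (fun x hx hnonneg => by
      have hF'' := h.deriv_deriv_pos_s15 (hI x hx) (hFa x hx) (hF' x hx) (sub_nonneg.1 hnonneg)
      have hs := hsin x hx
      have hc := hcos x hx
      have hS := hsinF x hx
      have hC := hcosF x hx
      have hF'x := hF' x hx
      exact neg_neg_of_pos (by positivity))
    (sub_nonneg.2 hcon)
  obtain ⟨x, hFx, hx⟩ := ((hlim.eventually_lt_const hδ).and (Ioo_mem_nhdsGT hb.1)).exists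
  have hxa : x ∈ Ioc 0 a := ⟨hx.1, hx.2.le.trans hb.2⟩
  have hSF : sin (F x) < F x := sin_lt (hFa x hxa).1
  have hSC : sin (F x) * cos (F x) ≤ sin (F x) :=
    mul_le_of_le_one_right (hsinF x hxa).le (cos_le_one _)
  have hSCc : sin (F x) * cos (F x) * cos x ≤ sin (F x) * cos (F x) :=
    mul_le_of_le_one_right (mul_pos (hsinF x hxa) (hcosF x hxa)).le (cos_le_one _)
  have hlex := hle x hx
  have hsF' := mul_pos (hsin x hxa) (hF' x hxa)
  linarith

/-- Two-sided derivative bound: for a solution `F` of the hedgehog Skyrme ODE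
with `F → 0` at `0⁺`, positive with positive derivative near `0`, one has
`sin(2F(ψ))/(2·tan ψ) < F'(ψ) < 2·F(ψ)/sin(2ψ)` for all sufficiently small `ψ > 0`. -/
theorem skyrme_two_sided_deriv_bound (κ : ℝ) (hκ : 0 < κ) (F : ℝ → ℝ)
    (hF : TwiceDiffOnIoo F) (hode : SkyrmeEq κ F)
    (hlim : Filter.Tendsto F (nhdsWithin 0 (Set.Ioi 0)) (nhds 0))
    (ε : ℝ) (hε : 0 < ε)
    (hpos : ∀ ψ ∈ Set.Ioo (0:ℝ) ε, 0 < F ψ ∧ 0 < deriv F ψ) :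
    ∀ᶠ ψ in nhdsWithin 0 (Set.Ioi (0:ℝ)),
      Real.sin (2 * F ψ) / (2 * Real.tan ψ) < deriv F ψ ∧
        deriv F ψ < 2 * F ψ / Real.sin (2 * ψ) := by
  have hpi : 0 < π / 2 := half_pos pi_pos
  have hev : ∀ᶠ x in 𝓝[>] (0 : ℝ), x < π / 2 ∧ F x ∈ Ioo 0 (π / 2) ∧ 0 < deriv F x := by
    filter_upwards [Ioo_mem_nhdsGT hpi, Ioo_mem_nhdsGT hε, hlim.eventually_lt_const hpi]
      with x hx hxε hFx
    exact ⟨hx.2, ⟨(hpos x hxε).1, hFx⟩, (hpos x hxε).2⟩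
  obtain ⟨r, hr, hsub⟩ := mem_nhdsGT_iff_exists_Ioo_subset.1 hev
  filter_upwards [Ioo_mem_nhdsGT hr] with x hx
  have hmem : ∀ y ∈ Ioc 0 x, F y ∈ Ioo 0 (π / 2) ∧ 0 < deriv F y :=
    fun y hy => (hsub ⟨hy.1, hy.2.trans_lt hx.2⟩).2
  have hxI : x ∈ Ioo 0 (π / 2) := ⟨hx.1, (hsub hx).1⟩
  have hs : 0 < sin x := sin_pos_of_pos_of_lt_pi hx.1 (by linarith [hxI.2, pi_pos])
  have hc : 0 < cos x := cos_pos_of_mem_Ioo ⟨by linarith [hx.1, pi_pos], hxI.2⟩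
  have hlower := hode.lt_sin_mul_deriv hF hlim hxI (fun y hy => (hmem y hy).1)
    fun y hy => (hmem y hy).2
  have hupper := hode.sin_mul_cos_mul_deriv_lt hF hxI (fun y hy => (hmem y hy).1)
    fun y hy => (hmem y hy).2
  constructor
  · have heq : sin (2 * F x) / (2 * tan x) = sin (F x) * cos (F x) * cos x / sin x := by
      rw [sin_two_mul, tan_eq_sin_div_cos]
      field_simp
    rw [heq, div_lt_iff₀ hs]
    linarith
  · rw [sin_two_mul, lt_div_iff₀ (by positivity)]
    linarith
end
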